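/- There is a universal constant C such that: in every directed polymatroidal network on n ≥ 3 nodes, for any multicommodity flow instance with symmetric demands on k ≥ 2 unordered pairs with demands D_1,…,D_k, if β is the value of the maximum concurrent flow, then there exists an edge set F whose sparsity ν(F)/D(F) is at most C·min{(log k)³, (log n)²·(log log n)}·β. -/

import Mathlib

open Finset MeasureTheory
open scoped ENNReal Classical

/-- A directed polymatroidal network: a finite directed graph together with,
for each node `v`, polymatroids `rhoM v` on the edges entering `v` and
`rhoP v` on the edges leaving `v`. -/
structure DirPolyNet (V E : Type) [Fintype V] [Fintype E] [DecidableEq V] [DecidableEq E] where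
  tail : E → V
  head : E → V
  rhoM : V → Finset E → ℝ
  rhoP : V → Finset E → ℝ
  rhoM_empty : ∀ v, rhoM v ∅ = 0
  rhoP_empty : ∀ v, rhoP v ∅ = 0
  rhoM_nonneg : ∀ v A, A ⊆ Finset.univ.filter (fun e => head e = v) → 0 ≤ rhoM v A
  rhoP_nonneg : ∀ v A, A ⊆ Finset.univ.filter (fun e => tail e = v) → 0 ≤ rhoP v A
  rhoM_mono : ∀ v A B, A ⊆ B → B ⊆ Finset.univ.filter (fun e => head e = v) →
    rhoM v A ≤ rhoM v B
  rhoP_mono : ∀ v A B, A ⊆ B → B ⊆ Finset.univ.filter (fun e => tail e = v) →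
    rhoP v A ≤ rhoP v B
  rhoM_submod : ∀ v A B, A ⊆ Finset.univ.filter (fun e => head e = v) →
    B ⊆ Finset.univ.filter (fun e => head e = v) →
    rhoM v (A ∪ B) + rhoM v (A ∩ B) ≤ rhoM v A + rhoM v B
  rhoP_submod : ∀ v A B, A ⊆ Finset.univ.filter (fun e => tail e = v) →
    B ⊆ Finset.univ.filter (fun e => tail e = v) →
    rhoP v (A ∪ B) + rhoP v (A ∩ B) ≤ rhoP v A + rhoP v B

namespace DirPolyNet

variable {V E : Type} [Fintype V] [Fintype E] [DecidableEq V] [DecidableEq E]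

/-- The set of edges entering `v` (the ground set of `rhoM v`). -/
def inE (N : DirPolyNet V E) (v : V) : Finset E :=
  Finset.univ.filter (fun e => N.head e = v)

/-- The set of edges leaving `v` (the ground set of `rhoP v`). -/
def outE (N : DirPolyNet V E) (v : V) : Finset E :=
  Finset.univ.filter (fun e => N.tail e = v)

/-- `g` is a valid assignment of the edges of `F` to endpoints. -/
def Valid (N : DirPolyNet V E) (F : Finset E) (g : E → V) : Prop :=
  ∀ e ∈ F, g e = N.tail e ∨ g e = N.head e

/-- The cost `ν(F)` of the edge cut `F`: the minimum over valid assignments `g`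
of `Σ_v (ρ⁻_v(δ⁻(v) ∩ g⁻¹(v)) + ρ⁺_v(δ⁺(v) ∩ g⁻¹(v)))`. -/
noncomputable def cutCost (N : DirPolyNet V E) (F : Finset E) : ℝ :=
  sInf { c : ℝ | ∃ g : E → V, N.Valid F g ∧
    c = ∑ v : V, (N.rhoM v ((N.inE v ∩ F).filter (fun e => g e = v)) +
                  N.rhoP v ((N.outE v ∩ F).filter (fun e => g e = v))) }

/-- `IsWalk N s t p`: the list of edges `p` forms a directed walk from `s` to `t`. -/
def IsWalk (N : DirPolyNet V E) : V → V → List E → Prop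
  | s, t, [] => s = t
  | s, t, e :: p => N.tail e = s ∧ IsWalk N (N.head e) t p

/-- The list of vertices visited by a walk starting at `s`. -/
def walkVerts (N : DirPolyNet V E) : V → List E → List V
  | s, [] => [s]
  | s, e :: p => s :: walkVerts N (N.head e) p

/-- A simple directed path from `s` to `t`. -/
def IsPath (N : DirPolyNet V E) (s t : V) (p : List E) : Prop :=
  N.IsWalk s t p ∧ (N.walkVerts s p).Nodup

/-- `F` separates the ordered pair `(s,t)`: there is no `s→t` path avoiding `F`. -/
def Separates (N : DirPolyNet V E) (F : Finset E) (s t : V) : Prop :=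
  ¬ ∃ p : List E, N.IsWalk s t p ∧ ∀ e ∈ p, e ∉ F

/-- Total flow on an edge `e`. -/
noncomputable def edgeFlow (N : DirPolyNet V E) {ι : Type} [Fintype ι]
    (f : ι → List E → ℝ) (e : E) : ℝ :=
  ∑ i : ι, ∑ᶠ p ∈ {p : List E | e ∈ p}, f i p

/-- The rate of commodity `i`. -/
noncomputable def rate {ι : Type} (f : ι → List E → ℝ) (i : ι) : ℝ :=
  ∑ᶠ p : List E, f i p

/-- A feasible multicommodity flow for the source-sink pairs `(s i, t i)`. -/
structure IsFlow (N : DirPolyNet V E) {ι : Type} [Fintype ι] (s t : ι → V)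
    (f : ι → List E → ℝ) : Prop where
  nonneg : ∀ i p, 0 ≤ f i p
  supp : ∀ i p, f i p ≠ 0 → N.IsPath (s i) (t i) p
  fin : ∀ i, (Function.support (f i)).Finite
  capM : ∀ v, ∀ S ⊆ N.inE v, ∑ e ∈ S, N.edgeFlow f e ≤ N.rhoM v S
  capP : ∀ v, ∀ S ⊆ N.outE v, ∑ e ∈ S, N.edgeFlow f e ≤ N.rhoP v S

/-- `D(F)`: the total demand of the pairs separated by `F`. -/
noncomputable def sepDemand (N : DirPolyNet V E) {ι : Type} [Fintype ι]
    (s t : ι → V) (D : ι → ℝ) (F : Finset E) : ℝ :=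
  ∑ i : ι, if N.Separates F (s i) (t i) then D i else 0

/-- The value of the maximum throughput multicommodity flow. -/
noncomputable def maxThroughput (N : DirPolyNet V E) {ι : Type} [Fintype ι]
    (s t : ι → V) : ℝ :=
  sSup { r : ℝ | ∃ f : ι → List E → ℝ, N.IsFlow s t f ∧ r = ∑ i : ι, rate f i }

/-- The value of the maximum concurrent multicommodity flow for demands `D`. -/
noncomputable def maxConcurrent (N : DirPolyNet V E) {ι : Type} [Fintype ι]
    (s t : ι → V) (D : ι → ℝ) : ℝ :=
  sSup { lam : ℝ | ∃ f : ι → List E → ℝ, N.IsFlow s t f ∧ ∀ i, rate f i = lam * D i }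

end DirPolyNet

namespace DirPolyNet

variable {V E : Type} [Fintype V] [Fintype E] [DecidableEq V] [DecidableEq E]

/-- Maximum concurrent flow for symmetric demands: the largest `λ` such that rates
`λ·D i` can be routed simultaneously for all `2k` ordered pairs `(s i, t i)`, `(t i, s i)`. -/
noncomputable def maxConcurrentSym (N : DirPolyNet V E) {k : ℕ}
    (s t : Fin k → V) (D : Fin k → ℝ) : ℝ :=
  sSup { lam : ℝ | ∃ f : (Fin k ⊕ Fin k) → List E → ℝ,
    N.IsFlow (Sum.elim s t) (Sum.elim t s) f ∧
    ∀ j : Fin k ⊕ Fin k, rate f j = lam * D (Sum.elim id id j) }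

/-- `D(F)` for symmetric demands: the total demand of the ordered pairs among
`(s i, t i), (t i, s i)` separated by `F` (with `D i` counted once for each
separated ordered pair). -/
noncomputable def sepDemandSym (N : DirPolyNet V E) {k : ℕ}
    (s t : Fin k → V) (D : Fin k → ℝ) (F : Finset E) : ℝ :=
  N.sepDemand (Sum.elim s t) (Sum.elim t s) (fun j => D (Sum.elim id id j)) F

end DirPolyNet

open DirPolyNet

theorem exists_light_threshold {A : Type*} (S : Finset A) (c p q : A → ℝ) {l u : ℝ} (hlu : l < u) :
    ∃ r ∈ Set.Ico l u, (u - l) * ∑ a ∈ S, (if p a ≤ r ∧ r < q a then c a else 0) ≤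
      ∑ a ∈ S, c a * max 0 (min u (q a) - max l (p a)) := by
  have hinteg : ∀ a, IntegrableOn ((Set.Ico (p a) (q a)).indicator fun _ => c a)
      (Set.Ico l u) volume := fun a =>
    (integrableOn_const (by simp)).indicator measurableSet_Ico
  obtain ⟨r, hr, h⟩ := exists_le_setAverage (μ := volume) (s := Set.Ico l u)
    (f := fun r => ∑ a ∈ S, (Set.Ico (p a) (q a)).indicator (fun _ => c a) r)
    (by simp [hlu]) (by simp) (integrable_finsetSum _ fun a _ => hinteg a)
  refine ⟨r, hr, ?_⟩
  rw [setAverage_eq, integral_finsetSum _ fun a _ => hinteg a] at h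
  have hpos : 0 < u - l := sub_pos.2 hlu
  have hval : ∀ a, ∫ x in Set.Ico l u, (Set.Ico (p a) (q a)).indicator (fun _ => c a) x =
      c a * max 0 (min u (q a) - max l (p a)) := by
    intro a
    rw [setIntegral_indicator measurableSet_Ico, Set.Ico_inter_Ico, setIntegral_const]
    simp [Measure.real, ENNReal.toReal_ofReal', mul_comm, max_comm]
  simp only [hval, smul_eq_mul, Measure.real, Real.volume_Ico, ENNReal.toReal_ofReal hpos.le] at h
  rw [inv_mul_eq_div, le_div_iff₀ hpos] at h
  rw [mul_comm]
  simpa [Set.indicator_apply] using h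

theorem sum_mul_le_sum_mul_of_layers {I A : Type*} [Fintype I] [Fintype A]
    (b δ : I → ℝ) (c h : A → ℝ) (hδ : ∀ i, 0 ≤ δ i) (hh : ∀ a, 0 ≤ h a)
    (H : ∀ τ : ℝ, 0 < τ → ∑ i, (if τ ≤ δ i then b i else 0) ≤ ∑ a, if τ ≤ h a then c a else 0) :
    ∑ i, b i * δ i ≤ ∑ a, c a * h a := by
  obtain ⟨M, hM⟩ : ∃ M : ℝ, (∀ i, δ i ≤ M) ∧ ∀ a, h a ≤ M :=
    ⟨∑ i, δ i + ∑ a, h a,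
      fun i => (single_le_sum (fun i _ => hδ i) (mem_univ i)).trans
        (le_add_of_nonneg_right (sum_nonneg fun a _ => hh a)),
      fun a => (single_le_sum (fun a _ => hh a) (mem_univ a)).trans
        (le_add_of_nonneg_left (sum_nonneg fun i _ => hδ i))⟩
  have hinteg : ∀ x y : ℝ, IntegrableOn (fun τ : ℝ => if τ ≤ x then y else 0)
      (Set.Ioc 0 M) volume := fun x y =>
    (integrableOn_const (by simp)).indicator (f := fun _ => y) (measurableSet_Iic (a := x))
  have hval : ∀ x y : ℝ, 0 ≤ x → x ≤ M →
      ∫ τ in Set.Ioc 0 M, (if τ ≤ x then y else 0) = y * x := by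
    intro x y hx hxM
    have : (fun τ : ℝ => if τ ≤ x then y else 0) = (Set.Iic x).indicator fun _ => y := by
      ext τ; simp [Set.indicator_apply]
    rw [this, setIntegral_indicator measurableSet_Iic, Set.Ioc_inter_Iic, min_eq_right hxM,
      setIntegral_const]
    simp [Measure.real, hx, mul_comm]
  have key := setIntegral_mono_on (μ := volume) (s := Set.Ioc 0 M)
    (integrable_finsetSum univ fun i _ => hinteg (δ i) (b i))
    (integrable_finsetSum univ fun a _ => hinteg (h a) (c a)) measurableSet_Ioc
    fun τ hτ => H τ hτ.1
  rw [integral_finsetSum _ fun i _ => hinteg (δ i) (b i),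
    integral_finsetSum _ fun a _ => hinteg (h a) (c a)] at key
  simpa only [hval _ _ (hδ _) (hM.1 _), hval _ _ (hh _) (hM.2 _)] using key

/-- Region growing: some ball of radius less than `ρ` has a boundary that is cheap in comparison
with its volume. -/
theorem exists_sparse_ball {X A : Type*} (S : Finset A) (tl hd : A → X) (c len : A → ℝ)
    (hc : ∀ a, 0 ≤ c a) (hlen : ∀ a, 0 ≤ len a) (φ : X → ℝ)
    (hφ : ∀ a, φ (hd a) ≤ φ (tl a) + len a) (T : Finset X) {x : X} (hx : x ∈ T) (hφx : φ x = 0)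
    {σ ρ : ℝ} (hσ : 0 < σ) (hρ : 0 < ρ) {L : ℕ} (hL : 0 < L)
    (hvol : σ * #T + ∑ a ∈ S, c a * len a ≤ 2 ^ L * σ) :
    ∃ r, 0 ≤ r ∧ r < ρ ∧
      ρ * ∑ a ∈ S, (if φ (tl a) ≤ r ∧ r < φ (hd a) then c a else 0) ≤
        2 * L * (σ * #(T.filter fun z => φ z ≤ r) +
          ∑ a ∈ S, if φ (tl a) ≤ r then c a * len a else 0) := by
  set vol : ℝ → ℝ := fun r => σ * #(T.filter fun z => φ z ≤ r) +
    ∑ a ∈ S, if φ (tl a) ≤ r then c a * len a else 0 with hvoldef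
  have hcl : ∀ a, 0 ≤ c a * len a := fun a => mul_nonneg (hc a) (hlen a)
  have hmono : Monotone vol := by
    intro r r' hrr
    refine add_le_add (mul_le_mul_of_nonneg_left (Nat.cast_le.2 (card_le_card ?_)) hσ.le)
      (sum_le_sum fun a _ => ?_)
    · exact fun z hz => by simp only [mem_filter] at hz ⊢; exact ⟨hz.1, hz.2.trans hrr⟩
    · split_ifs with h1 h2
      · rfl
      · exact absurd (h1.trans hrr) h2
      · exact hcl a
      · rfl
  have hL' : (0 : ℝ) < L := Nat.cast_pos.2 hL
  have h0 : σ ≤ vol 0 := by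
    have h1 : (1 : ℝ) ≤ #(T.filter fun z => φ z ≤ 0) := by
      exact_mod_cast card_pos.2 ⟨x, by simp [hx, hφx]⟩
    have h2 : 0 ≤ ∑ a ∈ S, if φ (tl a) ≤ 0 then c a * len a else 0 :=
      sum_nonneg fun a _ => by split_ifs; exacts [hcl a, le_rfl]
    have : σ * 1 ≤ σ * #(T.filter fun z => φ z ≤ 0) := mul_le_mul_of_nonneg_left h1 hσ.le
    simp only [hvoldef]; linarith
  have htop : ∀ r, vol r ≤ 2 ^ L * σ := by
    intro r
    refine le_trans (add_le_add (mul_le_mul_of_nonneg_left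
      (Nat.cast_le.2 (card_le_card (filter_subset _ _))) hσ.le) (sum_le_sum fun a _ => ?_)) hvol
    split_ifs; exacts [le_rfl, hcl a]
  obtain ⟨i, hi, hstep⟩ : ∃ i < L, vol ((i + 1 : ℕ) * (ρ / L)) ≤ 2 * vol (i * (ρ / L)) := by
    by_contra! hcon
    have hgrow : ∀ i, i ≤ L → 0 < i → 2 ^ i * vol 0 < vol (i * (ρ / L)) := by
      intro i
      induction i with
      | zero => intro _ h; exact absurd h (lt_irrefl _)
      | succ i ih =>
        intro hi _
        refine lt_of_le_of_lt ?_ (hcon i hi)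
        rcases Nat.eq_zero_or_pos i with rfl | hpos
        · simp
        · have := ih (by omega) hpos
          rw [pow_succ]; linarith
    have h1 := hgrow L le_rfl hL
    have h2 := htop (L * (ρ / L))
    have : (2 : ℝ) ^ L * σ ≤ 2 ^ L * vol 0 := by gcongr
    linarith
  have hlu : i * (ρ / L) < (i + 1 : ℕ) * (ρ / L) := by
    push_cast; have : 0 < ρ / L := by positivity
    linarith
  obtain ⟨r, hr, hcut⟩ := exists_light_threshold S c (fun a => φ (tl a)) (fun a => φ (hd a)) hlu
  have hi0 : (0 : ℝ) ≤ i * (ρ / L) := by positivity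
  refine ⟨r, hi0.trans hr.1, hr.2.trans_le ?_, ?_⟩
  · calc ((i + 1 : ℕ) : ℝ) * (ρ / L) ≤ L * (ρ / L) := by gcongr; exact_mod_cast hi
      _ = ρ := by field_simp
  have hshell : ∑ a ∈ S, c a * max 0 (min ((i + 1 : ℕ) * (ρ / L)) (φ (hd a)) -
      max (i * (ρ / L)) (φ (tl a))) ≤ vol ((i + 1 : ℕ) * (ρ / L)) := by
    refine le_trans (sum_le_sum fun a _ => ?_) (le_add_of_nonneg_left (by positivity))
    split_ifs with h
    · refine mul_le_mul_of_nonneg_left (max_le (hlen a) ?_) (hc a)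
      have := hφ a
      have h1 := min_le_right ((i + 1 : ℕ) * (ρ / L)) (φ (hd a))
      have h2 := le_max_right (i * (ρ / L)) (φ (tl a))
      linarith
    · have h1 := min_le_left ((i + 1 : ℕ) * (ρ / L)) (φ (hd a))
      have h2 := le_max_right (i * (ρ / L)) (φ (tl a))
      rw [max_eq_left (by push Not at h; linarith), mul_zero]
  have hlow : vol (i * (ρ / L)) ≤ vol r := hmono hr.1
  have heq : ((i + 1 : ℕ) : ℝ) * (ρ / L) - i * (ρ / L) = ρ / L := by push_cast; ring
  rw [heq] at hcut
  have h3 : ρ / L * ∑ a ∈ S, (if φ (tl a) ≤ r ∧ r < φ (hd a) then c a else 0) ≤ 2 * vol r := by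
    linarith
  rw [div_mul_eq_mul_div, div_le_iff₀ hL'] at h3
  linarith

/-- The terminal-weighted volume of the part `U`. -/
noncomputable def partVolume {X A : Type*} [DecidableEq X] [Fintype A] (tl hd : A → X) (c : A → ℝ)
    (d : X → X → ℝ) (T : Finset X) (σ : ℝ) (U : Finset X) : ℝ :=
  σ * #(T ∩ U) + ∑ a, if tl a ∈ U ∧ hd a ∈ U then c a * d (tl a) (hd a) else 0

/-- The part `U` admits a hierarchical decomposition recorded by edge heights of small total
cost: for every `τ`, the edges inside `U` of height less than `τ` respect a ranking that
distinguishes all pairs of terminals whose round-trip distance is at least `τ`. -/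
def HasHeights {X A : Type*} [DecidableEq X] [Fintype A] (tl hd : A → X) (c : A → ℝ)
    (d : X → X → ℝ) (T : Finset X) (σ K : ℝ) (U : Finset X) : Prop :=
  ∃ h : A → ℝ, (∀ a, 0 ≤ h a) ∧ (∀ a, d (tl a) (hd a) = 0 → h a = 0) ∧
    (∑ a, if tl a ∈ U ∧ hd a ∈ U then c a * h a else 0) ≤
      K * Nat.log 2 #(T ∩ U) * partVolume tl hd c d T σ U ∧
    ∀ τ, 0 < τ → ∃ π : X → ℤ,
      (∀ a, tl a ∈ U → hd a ∈ U → h a < τ → π (tl a) ≤ π (hd a)) ∧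
      ∀ x ∈ T ∩ U, ∀ y ∈ T ∩ U, τ ≤ d x y + d y x → π x ≠ π y

section Heights

variable {X A : Type*} [DecidableEq X] [Fintype A] {tl hd : A → X} {c : A → ℝ} {d : X → X → ℝ}
  {T U : Finset X} {σ K : ℝ}

theorem partVolume_reverse :
    partVolume hd tl c (fun x y => d y x) T σ U = partVolume tl hd c d T σ U := by
  simp only [partVolume, and_comm]

theorem HasHeights.reverse (H : HasHeights hd tl c (fun x y => d y x) T σ K U) :
    HasHeights tl hd c d T σ K U := by
  obtain ⟨h, h0, hz, hsum, hπ⟩ := H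
  refine ⟨h, h0, hz, ?_, fun τ hτ => ?_⟩
  · rw [partVolume_reverse] at hsum
    simpa only [and_comm] using hsum
  · obtain ⟨π, h1, h2⟩ := hπ τ hτ
    refine ⟨fun z => -π z, fun a ha hb hlt => neg_le_neg (h1 a hb ha hlt), fun x hx y hy hxy => ?_⟩
    simpa using h2 x hx y hy (by rwa [add_comm])

/-- Splitting off a sparse out-ball of radius less than `δ / 4`, where `δ` is the round-trip
diameter of the terminals of `U`. -/
theorem HasHeights.of_outBall (hc : ∀ a, 0 ≤ c a) (hd0 : ∀ x y, 0 ≤ d x y)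
    (hself : ∀ x, d x x = 0) (htri : ∀ x y z, d x z ≤ d x y + d y z) (hσ : 0 < σ)
    {L : ℕ} (hL : 0 < L) (hvol : partVolume tl hd c d T σ U ≤ 2 ^ L * σ)
    (IH : ∀ B, B ⊂ U → HasHeights tl hd c d T σ (8 * L) B)
    {x y : X} (hx : x ∈ T ∩ U) (hy : y ∈ T ∩ U) {δ : ℝ} (hδ : 0 < δ)
    (hmax : ∀ u ∈ T ∩ U, ∀ v ∈ T ∩ U, d u v + d v u ≤ δ) (hxy : δ / 4 ≤ d x y)
    (hsmall : 2 * #((T ∩ U).filter fun z => d x z < δ / 4) ≤ #(T ∩ U)) :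
    HasHeights tl hd c d T σ (8 * L) U := by
  have hcd : ∀ a, 0 ≤ c a * d (tl a) (hd a) := fun a => mul_nonneg (hc a) (hd0 _ _)
  obtain ⟨r, hr0, hrρ, hcut⟩ := exists_sparse_ball
    (univ.filter fun a => tl a ∈ U ∧ hd a ∈ U) tl hd c (fun a => d (tl a) (hd a)) hc
    (fun a => hd0 _ _) (d x) (fun a => htri _ _ _) (T ∩ U) hx (hself x) hσ
    (div_pos hδ four_pos) hL (by simpa only [sum_filter, partVolume] using hvol)
  set B := U.filter fun z => d x z ≤ r with hB
  have hBU : B ⊆ U := filter_subset _ _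
  have hxB : x ∈ B := by simp [hB, (mem_inter.1 hx).2, hself, hr0]
  have hyB : y ∉ B := by simp only [hB, mem_filter, not_and, not_le]; intro; linarith
  have hyU := (mem_inter.1 hy).2
  have hBss : B ⊂ U := ⟨hBU, fun h => hyB (h hyU)⟩
  have hCss : U \ B ⊂ U := sdiff_ssubset hBU ⟨x, hxB⟩
  obtain ⟨h₁, h₁0, h₁z, h₁s, h₁π⟩ := IH B hBss
  obtain ⟨h₂, h₂0, h₂z, h₂s, h₂π⟩ := IH (U \ B) hCss
  set outVol : ℝ := σ * #(T ∩ B) +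
    ∑ a, if tl a ∈ B ∧ hd a ∈ U then c a * d (tl a) (hd a) else 0 with houtVol
  have hcut' : δ * (∑ a, if tl a ∈ B ∧ hd a ∈ U \ B then c a else 0) ≤ 8 * L * outVol := by
    have e1 : (T ∩ U).filter (fun z => d x z ≤ r) = T ∩ B := by
      ext z; simp [hB, and_assoc]
    have e2 : ∀ a, (if tl a ∈ U ∧ hd a ∈ U then
        (if d x (tl a) ≤ r ∧ r < d x (hd a) then c a else 0) else 0) =
        if tl a ∈ B ∧ hd a ∈ U \ B then c a else 0 := by
      intro a
      rw [← ite_and]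
      refine if_congr ?_ rfl rfl
      simp only [hB, mem_filter, mem_sdiff, not_and, not_le]
      tauto
    have e3 : ∀ a, (if tl a ∈ U ∧ hd a ∈ U then
        (if d x (tl a) ≤ r then c a * d (tl a) (hd a) else 0) else 0) =
        if tl a ∈ B ∧ hd a ∈ U then c a * d (tl a) (hd a) else 0 := by
      intro a
      rw [← ite_and]
      refine if_congr ?_ rfl rfl
      simp only [hB, mem_filter]
      tauto
    rw [e1, sum_filter, sum_filter] at hcut
    simp only [e2, e3] at hcut
    linarith
  have hVB : partVolume tl hd c d T σ B ≤ outVol := by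
    refine add_le_add_right (sum_le_sum fun a _ => ?_) _
    split_ifs with h1 h2 h2
    · rfl
    · exact absurd ⟨h1.1, hBU h1.2⟩ h2
    · exact hcd a
    · rfl
  have hVU : outVol + partVolume tl hd c d T σ (U \ B) ≤ partVolume tl hd c d T σ U := by
    have hcard : (#(T ∩ B) : ℝ) + #(T ∩ (U \ B)) = #(T ∩ U) := by
      rw [← Nat.cast_add, ← card_union_of_disjoint, ← inter_union_distrib_left,
        union_sdiff_of_subset hBU]
      exact disjoint_sdiff.mono inter_subset_right inter_subset_right
    have hsum : (∑ a, if tl a ∈ B ∧ hd a ∈ U then c a * d (tl a) (hd a) else 0) +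
        (∑ a, if tl a ∈ U \ B ∧ hd a ∈ U \ B then c a * d (tl a) (hd a) else 0) ≤
        ∑ a, if tl a ∈ U ∧ hd a ∈ U then c a * d (tl a) (hd a) else 0 := by
      rw [← sum_add_distrib]
      refine sum_le_sum fun a _ => ?_
      have := hcd a
      simp only [mem_sdiff]
      have := @hBU (tl a)
      split_ifs <;> first | linarith | tauto
    simp only [houtVol, partVolume, ← hcard]
    linarith
  have hV0 : ∀ W, 0 ≤ partVolume tl hd c d T σ W := fun W =>
    add_nonneg (by positivity) (sum_nonneg fun a _ => by split_ifs; exacts [hcd a, le_rfl])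
  have hout0 : 0 ≤ outVol := (hV0 B).trans hVB
  have hlogB : Nat.log 2 #(T ∩ B) + 1 ≤ Nat.log 2 #(T ∩ U) := by
    have hpos : #(T ∩ B) ≠ 0 := card_ne_zero_of_mem (mem_inter.2 ⟨(mem_inter.1 hx).1, hxB⟩)
    rw [← Nat.log_mul_base one_lt_two hpos]
    refine Nat.log_mono_right (le_trans ?_ hsmall)
    rw [mul_comm]
    refine Nat.mul_le_mul_left _ (card_le_card fun z hz => ?_)
    simp only [hB, mem_inter, mem_filter] at hz ⊢
    exact ⟨⟨hz.1, hz.2.1⟩, hz.2.2.trans_lt hrρ⟩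
  have hlogC : Nat.log 2 #(T ∩ (U \ B)) ≤ Nat.log 2 #(T ∩ U) :=
    Nat.log_mono_right (card_le_card (inter_subset_inter_left sdiff_subset))
  refine ⟨fun a => if tl a ∈ B ∧ hd a ∈ B then h₁ a else
    if tl a ∈ U \ B ∧ hd a ∈ U \ B then h₂ a else
    if tl a ∈ B ∧ hd a ∈ U \ B then δ else 0, ?_, ?_, ?_, ?_⟩
  · intro a
    dsimp only
    split_ifs
    exacts [h₁0 a, h₂0 a, hδ.le, le_rfl]
  · intro a ha
    dsimp only
    split_ifs with h1 h2 h3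
    · exact h₁z a ha
    · exact h₂z a ha
    · exfalso
      simp only [hB, mem_filter, mem_sdiff, not_and, not_le] at h3
      have := htri x (tl a) (hd a)
      have := h3.2.2 h3.2.1
      linarith [h3.1.2]
    · rfl
  · have hle : ∀ a, (if tl a ∈ U ∧ hd a ∈ U then c a * (if tl a ∈ B ∧ hd a ∈ B then h₁ a else
        if tl a ∈ U \ B ∧ hd a ∈ U \ B then h₂ a else
        if tl a ∈ B ∧ hd a ∈ U \ B then δ else 0) else 0) ≤
        (if tl a ∈ B ∧ hd a ∈ B then c a * h₁ a else 0) +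
        (if tl a ∈ U \ B ∧ hd a ∈ U \ B then c a * h₂ a else 0) +
        δ * (if tl a ∈ B ∧ hd a ∈ U \ B then c a else 0) := by
      intro a
      have p1 : 0 ≤ c a * h₁ a := mul_nonneg (hc a) (h₁0 a)
      have p2 : 0 ≤ c a * h₂ a := mul_nonneg (hc a) (h₂0 a)
      have p3 : 0 ≤ δ * c a := mul_nonneg hδ.le (hc a)
      have p4 := mul_comm δ (c a)
      split_ifs <;> linarith
    refine (sum_le_sum fun a _ => hle a).trans ?_
    rw [sum_add_distrib, sum_add_distrib, ← mul_sum]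
    have k0 : (0 : ℝ) ≤ 8 * L := by positivity
    have kB : (Nat.log 2 #(T ∩ B) : ℝ) + 1 ≤ Nat.log 2 #(T ∩ U) := by exact_mod_cast hlogB
    have kC : (Nat.log 2 #(T ∩ (U \ B)) : ℝ) ≤ Nat.log 2 #(T ∩ U) := by exact_mod_cast hlogC
    calc _ ≤ 8 * L * Nat.log 2 #(T ∩ B) * outVol +
          8 * L * Nat.log 2 #(T ∩ U) * partVolume tl hd c d T σ (U \ B) + 8 * L * outVol := by
          refine add_le_add (add_le_add (h₁s.trans ?_) (h₂s.trans ?_)) hcut'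
          · gcongr
          · have := hV0 (U \ B)
            gcongr
      _ = 8 * L * ((Nat.log 2 #(T ∩ B) + 1) * outVol +
          Nat.log 2 #(T ∩ U) * partVolume tl hd c d T σ (U \ B)) := by ring
      _ ≤ 8 * L * (Nat.log 2 #(T ∩ U) * outVol +
          Nat.log 2 #(T ∩ U) * partVolume tl hd c d T σ (U \ B)) := by gcongr
      _ = 8 * L * Nat.log 2 #(T ∩ U) * (outVol + partVolume tl hd c d T σ (U \ B)) := by ring
      _ ≤ _ := by gcongr
  · intro τ hτ
    rcases lt_or_ge δ τ with hτδ | hτδ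
    · exact ⟨fun _ => 0, fun _ _ _ _ => le_rfl, fun u hu v hv huv =>
        absurd (huv.trans (hmax u hu v hv)) (not_le.2 hτδ)⟩
    obtain ⟨π₁, m₁, s₁⟩ := h₁π τ hτ
    obtain ⟨π₂, m₂, s₂⟩ := h₂π τ hτ
    set N : ℤ := ∑ z ∈ U, (|π₁ z| + |π₂ z|) + 1 with hN
    have hbd : ∀ u ∈ U, ∀ v ∈ U, u ≠ v → π₂ u < N + π₁ v := by
      intro u hu v hv huv
      have h1 : ∑ z ∈ {u, v}, (|π₁ z| + |π₂ z|) ≤ ∑ z ∈ U, (|π₁ z| + |π₂ z|) :=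
        sum_le_sum_of_subset_of_nonneg (by simp [insert_subset_iff, hu, hv])
          fun _ _ _ => by positivity
      rw [sum_pair huv] at h1
      have := le_abs_self (π₂ u)
      have := neg_abs_le (π₁ v)
      have := abs_nonneg (π₁ u)
      have := abs_nonneg (π₂ v)
      linarith
    refine ⟨fun z => if z ∈ B then N + π₁ z else π₂ z, ?_, ?_⟩
    · intro a htU hhU hlt
      dsimp only at hlt ⊢
      by_cases htB : tl a ∈ B <;> by_cases hhB : hd a ∈ B <;>
        simp only [htB, hhB, htU, hhU, mem_sdiff, not_true_eq_false, not_false_eq_true, and_true,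
          and_false, and_self, if_true, if_false] at hlt ⊢
      · exact add_le_add_right (m₁ a htB hhB hlt) _
      · exact absurd hlt (not_lt.2 hτδ)
      · exact (hbd _ htU _ hhU fun h => htB (h ▸ hhB)).le
      · exact m₂ a (by simp [htU, htB]) (by simp [hhU, hhB]) hlt
    · intro u hu v hv huv
      rw [mem_inter] at hu hv
      dsimp only
      by_cases huB : u ∈ B <;> by_cases hvB : v ∈ B <;> simp only [huB, hvB, if_true, if_false]
      · have := s₁ u (by simp [huB, hu]) v (by simp [hvB, hv]) huv
        simpa using this
      · exact (hbd v hv.2 u hu.2 fun h => hvB (h ▸ huB)).ne'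
      · exact (hbd u hu.2 v hv.2 fun h => huB (h ▸ hvB)).ne
      · exact s₂ u (by simp [huB, hu]) v (by simp [hvB, hv]) huv

theorem hasHeights_of_partVolume_le (hc : ∀ a, 0 ≤ c a) (hd0 : ∀ x y, 0 ≤ d x y)
    (hself : ∀ x, d x x = 0) (htri : ∀ x y z, d x z ≤ d x y + d y z) (hσ : 0 < σ)
    {L : ℕ} (hL : 0 < L) (U : Finset X) (hvol : partVolume tl hd c d T σ U ≤ 2 ^ L * σ) :
    HasHeights tl hd c d T σ (8 * L) U := by
  have hcd : ∀ a, 0 ≤ c a * d (tl a) (hd a) := fun a => mul_nonneg (hc a) (hd0 _ _)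
  have hV0 : ∀ W, 0 ≤ partVolume tl hd c d T σ W := fun W =>
    add_nonneg (by positivity) (sum_nonneg fun a _ => by split_ifs; exacts [hcd a, le_rfl])
  induction U using Finset.strongInduction with
  | H U ih =>
  have IH : ∀ B, B ⊂ U → HasHeights tl hd c d T σ (8 * L) B := by
    refine fun B hB => ih B hB (le_trans (add_le_add ?_ (sum_le_sum fun a _ => ?_)) hvol)
    · have := card_le_card (inter_subset_inter_left hB.1 : T ∩ B ⊆ T ∩ U)
      gcongr
    · split_ifs with h1 h2 h2
      · rfl
      · exact absurd ⟨hB.1 h1.1, hB.1 h1.2⟩ h2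
      · exact hcd a
      · rfl
  by_cases hflat : ∀ u ∈ T ∩ U, ∀ v ∈ T ∩ U, d u v + d v u ≤ 0
  · refine ⟨fun _ => 0, fun _ => le_rfl, fun _ _ => rfl, ?_, fun τ hτ =>
      ⟨fun _ => 0, fun _ _ _ _ => le_rfl, fun u hu v hv huv =>
        absurd (huv.trans (hflat u hu v hv)) (not_le.2 hτ)⟩⟩
    have := hV0 U
    simp only [mul_zero, ite_self, sum_const_zero]
    positivity
  push Not at hflat
  obtain ⟨u, hu, v, hv, huv⟩ := hflat
  obtain ⟨⟨x, y⟩, hxy, hmax⟩ := exists_max_image ((T ∩ U) ×ˢ (T ∩ U))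
    (fun p => d p.1 p.2 + d p.2 p.1) ⟨(u, v), mem_product.2 ⟨hu, hv⟩⟩
  rw [mem_product] at hxy
  set δ := d x y + d y x with hδdef
  have hδ : 0 < δ := huv.trans_le (hmax (u, v) (mem_product.2 ⟨hu, hv⟩))
  have hmax' : ∀ u ∈ T ∩ U, ∀ v ∈ T ∩ U, d u v + d v u ≤ δ := fun u hu v hv =>
    hmax (u, v) (mem_product.2 ⟨hu, hv⟩)
  obtain ⟨x', hx', y', hy', hfar⟩ : ∃ x ∈ T ∩ U, ∃ y ∈ T ∩ U, δ / 2 ≤ d x y := by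
    rcases le_total (d x y) (d y x) with h | h
    · exact ⟨y, hxy.2, x, hxy.1, by linarith⟩
    · exact ⟨x, hxy.1, y, hxy.2, by linarith⟩
  by_cases hsmall : 2 * #((T ∩ U).filter fun z => d x' z < δ / 4) ≤ #(T ∩ U)
  · exact HasHeights.of_outBall hc hd0 hself htri hσ hL hvol IH hx' hy' hδ hmax'
      (by linarith) hsmall
  · refine HasHeights.reverse (HasHeights.of_outBall hc (fun x y => hd0 y x) hself
      (fun x y z => by rw [add_comm]; exact htri z y x) hσ hL
      (by rwa [partVolume_reverse]) (fun B hB => HasHeights.reverse (IH B hB)) hy' hx' hδ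
      (fun u hu v hv => hmax' v hv u hu) (by linarith) ?_)
    have hdisj : Disjoint ((T ∩ U).filter fun z => d x' z < δ / 4)
        ((T ∩ U).filter fun z => d z y' < δ / 4) := by
      rw [disjoint_filter]
      intro z _ h1 h2
      have := htri x' z y'
      linarith
    have := card_le_card (union_subset (filter_subset (fun z => d x' z < δ / 4) (T ∩ U))
      (filter_subset (fun z => d z y' < δ / 4) (T ∩ U)))
    rw [card_union_of_disjoint hdisj] at this
    omega

end Heights

/-- A finite family of nonnegative reals takes its values in an increasing sequence that starts
at `0`. -/
theorem exists_monotone_levels {ι : Type*} [Fintype ι] (u : ι → ℝ) (hu : ∀ i, 0 ≤ u i) :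
    ∃ (θ : ℕ → ℝ) (M : ℕ) (p : ι → ℕ), θ 0 = 0 ∧ Monotone θ ∧ ∀ i, p i ≤ M ∧ θ (p i) = u i := by
  set S : Finset ℝ := insert 0 (univ.image u) with hS
  have hpos : 0 < #S := card_pos.2 ⟨0, mem_insert_self _ _⟩
  have hlt : ∀ j, min j (#S - 1) < #S := fun j => by omega
  have hmem : ∀ i, ∃ j : Fin #S, S.orderEmbOfFin rfl j = u i := by
    intro i
    have : u i ∈ (S : Set ℝ) := by simp [hS]
    rwa [← Finset.range_orderEmbOfFin S rfl] at this
  choose p hp using hmem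
  refine ⟨fun j => S.orderEmbOfFin rfl ⟨min j (#S - 1), hlt j⟩, #S, fun i => p i, ?_, ?_, ?_⟩
  · have h0 := Finset.orderEmbOfFin_zero (s := S) rfl hpos
    simp only [Nat.zero_min]
    rw [h0]
    refine le_antisymm (min'_le _ _ (mem_insert_self _ _)) (le_min' _ _ _ fun y hy => ?_)
    rcases mem_insert.1 hy with rfl | hy
    · rfl
    · obtain ⟨i, _, rfl⟩ := mem_image.1 hy
      exact hu i
  · intro i j hij
    refine (S.orderEmbOfFin rfl).monotone ?_
    simp only [Fin.mk_le_mk]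
    omega
  · intro i
    refine ⟨(p i).2.le, ?_⟩
    rw [← hp i]
    refine congrArg _ (Fin.ext ?_)
    have := (p i).2
    simp only
    omega

/-- Greedy algorithm for polymatroids: some vector of the polytope is tight on all level sets
of `p`. -/
theorem exists_greedy_vector {E : Type*} [DecidableEq E] (ρ : Finset E → ℝ) (h0 : ρ ∅ = 0)
    (p : E → ℕ) (G : Finset E) (hmono : ∀ A B, A ⊆ B → B ⊆ G → ρ A ≤ ρ B)
    (hsub : ∀ A B, A ⊆ G → B ⊆ G → ρ (A ∪ B) + ρ (A ∩ B) ≤ ρ A + ρ B) :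
    ∃ x : E → ℝ, (∀ e, 0 ≤ x e) ∧ (∀ S ⊆ G, ∑ e ∈ S, x e ≤ ρ S) ∧
      ∀ j, ∑ e ∈ G with j ≤ p e, x e = ρ (G.filter fun e => j ≤ p e) := by
  induction G using Finset.induction_on_min_value p with
  | empty =>
    refine ⟨fun _ => 0, fun _ => le_rfl, fun S hS => ?_, fun j => by simp [h0]⟩
    simp [subset_empty.1 hS, h0]
  | insert e G he hmin ih =>
    have hG := subset_insert e G
    obtain ⟨x, hx0, hxS, hxj⟩ := ih (fun A B hAB hB => hmono A B hAB (hB.trans hG))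
      fun A B hA hB => hsub A B (hA.trans hG) (hB.trans hG)
    have hfull : ∑ a ∈ G, x a = ρ G := by
      have := hxj (p e)
      rwa [filter_true_of_mem hmin] at this
    have hsum : ∀ S, e ∉ S → ∑ a ∈ S, Function.update x e (ρ (insert e G) - ρ G) a =
        ∑ a ∈ S, x a := fun S hS =>
      sum_congr rfl fun a ha => Function.update_of_ne (ne_of_mem_of_not_mem ha hS) _ _
    refine ⟨Function.update x e (ρ (insert e G) - ρ G), ?_, ?_, ?_⟩
    · intro a
      rcases eq_or_ne a e with rfl | ha
      · simpa using hmono _ _ hG subset_rfl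
      · simpa [Function.update_of_ne ha] using hx0 a
    · intro S hS
      by_cases heS : e ∈ S
      · rw [← sum_erase_add _ _ heS, hsum _ (notMem_erase _ _), Function.update_self]
        have hSG : S.erase e ⊆ G := by
          intro a ha
          rw [mem_erase] at ha
          exact (mem_insert.1 (hS ha.2)).resolve_left ha.1
        have h1 := hxS _ hSG
        have h2 := hsub S G hS hG
        have h3 : S ∪ G = insert e G := by
          ext a
          have := @hS a
          simp only [mem_union, mem_insert] at this ⊢
          constructor
          · tauto
          · rintro (rfl | h) <;> tauto
        have h4 : S ∩ G = S.erase e := by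
          ext a
          have := @hSG a
          simp only [mem_inter, mem_erase] at this ⊢
          constructor
          · rintro ⟨h, h'⟩
            exact ⟨fun h'' => he (h'' ▸ h'), h⟩
          · tauto
        rw [h3, h4] at h2
        linarith
      · rw [hsum _ heS]
        exact hxS S fun a ha => (mem_insert.1 (hS ha)).resolve_left fun h => heS (h ▸ ha)
    · intro j
      by_cases hj : j ≤ p e
      · have hall : ∀ a ∈ insert e G, j ≤ p a := by
          intro a ha
          rcases mem_insert.1 ha with rfl | ha
          exacts [hj, hj.trans (hmin a ha)]
        rw [filter_true_of_mem hall, sum_insert he, hsum _ he, Function.update_self, hfull]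
        ring
      · rw [filter_insert, if_neg hj, hsum _ (by simp [he]), hxj]

/-- A subset of an upper level set of a polymatroid costs at most the sum of all selected
levels. -/
theorem le_sum_levels {E : Type*} {ρ : Finset E → ℝ} (h0 : ρ ∅ = 0) (p : E → ℕ)
    {G : Finset E} (hnn : ∀ A ⊆ G, 0 ≤ ρ A) (hmono : ∀ A B, A ⊆ B → B ⊆ G → ρ A ≤ ρ B)
    {M : ℕ} (Q : Fin M → Prop) {R : Finset E} (hR : R ⊆ G)
    (hRQ : ∀ e ∈ R, ∃ j : Fin M, (j : ℕ) + 1 ≤ p e ∧ Q j) :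
    ρ R ≤ ∑ j : Fin M, if Q j then ρ (G.filter fun e => (j : ℕ) + 1 ≤ p e) else 0 := by
  have hterm : ∀ j : Fin M, 0 ≤ if Q j then ρ (G.filter fun e => (j : ℕ) + 1 ≤ p e) else 0 := by
    intro j
    split_ifs
    exacts [hnn _ (filter_subset _ _), le_rfl]
  rcases R.eq_empty_or_nonempty with rfl | ⟨e₀, he₀⟩
  · rw [h0]
    exact sum_nonneg fun j _ => hterm j
  obtain ⟨j₀, _, hj₀⟩ := hRQ e₀ he₀
  obtain ⟨i, hi, hmin⟩ := exists_min_image (univ.filter Q) id ⟨j₀, by simpa using hj₀⟩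
  simp only [mem_filter, mem_univ, true_and, id] at hi hmin
  calc ρ R ≤ ρ (G.filter fun e => (i : ℕ) + 1 ≤ p e) := by
        refine hmono _ _ (fun e he => mem_filter.2 ⟨hR he, ?_⟩) (filter_subset _ _)
        obtain ⟨j, hj, hQ⟩ := hRQ e he
        have : (i : ℕ) ≤ j := hmin j hQ
        omega
    _ = if Q i then ρ (G.filter fun e => (i : ℕ) + 1 ≤ p e) else 0 := by rw [if_pos hi]
    _ ≤ _ := single_le_sum (fun j _ => hterm j) (mem_univ i)

namespace DirPolyNet

variable {V E : Type} [Fintype V] [Fintype E] [DecidableEq V] [DecidableEq E]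
  (N : DirPolyNet V E)

theorem cutCost_nonneg (F : Finset E) : 0 ≤ N.cutCost F := by
  refine Real.sInf_nonneg ?_
  rintro _ ⟨g, -, rfl⟩
  refine sum_nonneg fun v _ => add_nonneg (N.rhoM_nonneg v _ ?_) (N.rhoP_nonneg v _ ?_)
  · exact (filter_subset _ _).trans inter_subset_left
  · exact (filter_subset _ _).trans inter_subset_left

theorem cutCost_le {F : Finset E} {g : E → V} (hg : N.Valid F g) :
    N.cutCost F ≤ ∑ v : V, (N.rhoM v ((N.inE v ∩ F).filter (fun e => g e = v)) +
      N.rhoP v ((N.outE v ∩ F).filter (fun e => g e = v))) := by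
  refine csInf_le ⟨0, ?_⟩ ⟨g, hg, rfl⟩
  rintro _ ⟨g, -, rfl⟩
  refine sum_nonneg fun v _ => add_nonneg (N.rhoM_nonneg v _ ?_) (N.rhoP_nonneg v _ ?_)
  · exact (filter_subset _ _).trans inter_subset_left
  · exact (filter_subset _ _).trans inter_subset_left

/-- Tails of the edges of the auxiliary digraph in which every node `v` of `N` is replaced by the
line `{v} × ℝ`, subdivided at `±θ j`, where the edge `e` of `N` leaves at level `θ (p e)` and
enters at level `-θ (q e)`. -/
def lineTail (θ : ℕ → ℝ) (M : ℕ) (p : E → ℕ) : (V × Fin M) ⊕ (V × Fin M) ⊕ E → V × ℝ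
  | .inl (v, j) => (v, θ j)
  | .inr (.inl (v, j)) => (v, -θ (j + 1))
  | .inr (.inr e) => (N.tail e, θ (p e))

/-- Heads of the edges of the auxiliary digraph, see `lineTail`. -/
def lineHead (θ : ℕ → ℝ) (M : ℕ) (q : E → ℕ) : (V × Fin M) ⊕ (V × Fin M) ⊕ E → V × ℝ
  | .inl (v, j) => (v, θ (j + 1))
  | .inr (.inl (v, j)) => (v, -θ j)
  | .inr (.inr e) => (N.head e, -θ (q e))

/-- Capacities of the edges of the auxiliary digraph, see `lineTail`. The edges of `N` itself have
length zero there and are never cut, so that their capacity is irrelevant. -/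
noncomputable def lineCap (M : ℕ) (p q : E → ℕ) : (V × Fin M) ⊕ (V × Fin M) ⊕ E → ℝ
  | .inl (v, j) => N.rhoP v ((N.outE v).filter fun e => (j : ℕ) + 1 ≤ p e)
  | .inr (.inl (v, j)) => N.rhoM v ((N.inE v).filter fun e => (j : ℕ) + 1 ≤ q e)
  | .inr (.inr _) => 0

theorem lineCap_nonneg (M : ℕ) (p q : E → ℕ) (a) : 0 ≤ N.lineCap M p q a := by
  rcases a with ⟨v, j⟩ | ⟨v, j⟩ | e
  · exact N.rhoP_nonneg v _ (filter_subset _ _)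
  · exact N.rhoM_nonneg v _ (filter_subset _ _)
  · exact le_rfl

/-- The edges of `N` one of whose subdivided halves contains a segment of height at least `τ`. -/
noncomputable def heightCut (M : ℕ) (p q : E → ℕ) (h : (V × Fin M) ⊕ (V × Fin M) ⊕ E → ℝ) (τ : ℝ) :
    Finset E :=
  univ.filter fun e => N.tail e ≠ N.head e ∧
    ((∃ j : Fin M, (j : ℕ) + 1 ≤ p e ∧ τ ≤ h (.inl (N.tail e, j))) ∨
      ∃ j : Fin M, (j : ℕ) + 1 ≤ q e ∧ τ ≤ h (.inr (.inl (N.head e, j))))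

theorem cutCost_heightCut_le (M : ℕ) (p q : E → ℕ) (h : (V × Fin M) ⊕ (V × Fin M) ⊕ E → ℝ)
    (τ : ℝ) : N.cutCost (N.heightCut M p q h τ) ≤
      ∑ a, if τ ≤ h a then N.lineCap M p q a else 0 := by
  have hvalid : N.Valid (N.heightCut M p q h τ) fun e =>
      if ∃ j : Fin M, (j : ℕ) + 1 ≤ p e ∧ τ ≤ h (.inl (N.tail e, j)) then N.tail e
      else N.head e := by
    intro e _
    dsimp only
    split_ifs <;> simp
  refine (N.cutCost_le hvalid).trans ?_
  rw [Fintype.sum_sum_type, Fintype.sum_sum_type, Fintype.sum_prod_type, Fintype.sum_prod_type,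
    ← add_assoc, ← sum_add_distrib]
  have hE : ∑ e : E, (if τ ≤ h (.inr (.inr e)) then N.lineCap M p q (.inr (.inr e)) else 0) = 0 :=
    sum_eq_zero fun e _ => by simp [lineCap]
  rw [hE, add_zero]
  refine sum_le_sum fun v _ => ?_
  rw [add_comm]
  refine add_le_add ?_ ?_
  · refine le_sum_levels (N.rhoP_empty v) p (N.rhoP_nonneg v) (N.rhoP_mono v)
      (fun j => τ ≤ h (.inl (v, j))) ((filter_subset _ _).trans inter_subset_left) ?_
    intro e he
    simp only [mem_filter, mem_inter, heightCut, outE, mem_univ, true_and] at he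
    obtain ⟨⟨htail, hloop, hor⟩, hg⟩ := he
    subst htail
    split_ifs at hg with hj
    · exact hj
    · exact absurd hg.symm hloop
  · refine le_sum_levels (N.rhoM_empty v) q (N.rhoM_nonneg v) (N.rhoM_mono v)
      (fun j => τ ≤ h (.inr (.inl (v, j)))) ((filter_subset _ _).trans inter_subset_left) ?_
    intro e he
    simp only [mem_filter, mem_inter, heightCut, inE, mem_univ, true_and] at he
    obtain ⟨⟨hhead, hloop, hor⟩, hg⟩ := he
    subst hhead
    split_ifs at hg with hj
    · exact absurd hg hloop
    · exact hor.resolve_left hj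

theorem le_of_isWalk_of_notMem_heightCut {θ : ℕ → ℝ} (hθ : θ 0 = 0) {M : ℕ} {p q : E → ℕ}
    (hp : ∀ e, p e ≤ M) (hq : ∀ e, q e ≤ M) {h : (V × Fin M) ⊕ (V × Fin M) ⊕ E → ℝ} {τ : ℝ}
    (hzero : ∀ e, h (.inr (.inr e)) < τ) {π : V × ℝ → ℤ}
    (hπ : ∀ a, h a < τ → π (N.lineTail θ M p a) ≤ π (N.lineHead θ M q a)) (l : List E) (u w : V)
    (hwalk : N.IsWalk u w l) (hl : ∀ e ∈ l, e ∉ N.heightCut M p q h τ) :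
    π (u, 0) ≤ π (w, 0) := by
  induction l generalizing u with
  | nil => rw [show u = w from hwalk]
  | cons e l ih =>
    obtain ⟨rfl, hwalk⟩ := hwalk
    refine le_trans ?_ (ih _ hwalk fun e' he' => hl e' (List.mem_cons_of_mem _ he'))
    have he := hl e List.mem_cons_self
    by_cases hloop : N.tail e = N.head e
    · rw [hloop]
    simp only [heightCut, mem_filter, mem_univ, true_and, not_and, not_or, not_exists, not_le]
      at he
    obtain ⟨hout, hin⟩ := he hloop
    have h1 : ∀ i, i ≤ p e → π (N.tail e, 0) ≤ π (N.tail e, θ i) := by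
      intro i
      induction i with
      | zero => intro _; rw [hθ]
      | succ i ihi =>
        intro hi
        exact (ihi (by omega)).trans
          (hπ (.inl (N.tail e, ⟨i, by have := hp e; omega⟩)) (hout _ hi))
    have h2 : ∀ i, i ≤ q e → π (N.head e, -θ i) ≤ π (N.head e, 0) := by
      intro i
      induction i with
      | zero => intro _; rw [hθ, neg_zero]
      | succ i ihi =>
        intro hi
        exact (hπ (.inr (.inl (N.head e, ⟨i, by have := hq e; omega⟩))) (hin _ hi)).trans
          (ihi (by omega))
    exact (h1 _ le_rfl).trans ((hπ (.inr (.inr e)) (hzero e)).trans (h2 _ le_rfl))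

set_option maxHeartbeats 1000000 in
/-- Rounding of a fractional cut: if every edge set has sparsity at least `κ`, then the
lengths `θ (p e) + θ (q e)` cannot place the demand pairs far apart at a small cost. -/
theorem mul_sum_dist_le_of_sparsity {k : ℕ} {s t : Fin k → V} {D : Fin k → ℝ}
    (hD : ∀ i, 0 ≤ D i) {θ : ℕ → ℝ} (hθ : θ 0 = 0)
    (hθmono : Monotone θ) {M : ℕ} {p q : E → ℕ} (hp : ∀ e, p e ≤ M) (hq : ∀ e, q e ≤ M)
    {dist : V → V → ℝ} (hd0 : ∀ u v, 0 ≤ dist u v) (hself : ∀ u, dist u u = 0)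
    (htri : ∀ u v w, dist u w ≤ dist u v + dist v w)
    (hlen : ∀ e, dist (N.tail e) (N.head e) ≤ θ (p e) + θ (q e)) {ω : ℝ} (hω : 0 < ω)
    (hcost : ∑ v, ∑ j : Fin M, (θ (j + 1) - θ j) *
      (N.rhoP v ((N.outE v).filter fun e => (j : ℕ) + 1 ≤ p e) +
        N.rhoM v ((N.inE v).filter fun e => (j : ℕ) + 1 ≤ q e)) ≤ ω)
    {Tm : Finset V} (hs : ∀ i, s i ∈ Tm) (ht : ∀ i, t i ∈ Tm) (hTm : Tm.Nonempty)
    {L : ℕ} (hL : 0 < L) (hTL : 2 * #Tm ≤ 2 ^ L)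
    {κ : ℝ} (hκ : 0 ≤ κ) (H : ∀ F, κ * N.sepDemandSym s t D F ≤ N.cutCost F) :
    κ * ∑ i, D i * (dist (s i) (t i) + dist (t i) (s i)) ≤
      16 * L * Nat.log 2 #Tm * ω := by
  set tl := N.lineTail θ M p with htl
  set hd := N.lineHead θ M q with hhd
  set c := N.lineCap M p q with hcdef
  set d : V × ℝ → V × ℝ → ℝ := fun x y => max 0 (dist x.1 y.1 + y.2 - x.2) with hddef
  have hc := N.lineCap_nonneg M p q
  have hm : (0 : ℝ) < #Tm := Nat.cast_pos.2 hTm.card_pos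
  set T : Finset (V × ℝ) := Tm.map ⟨fun v => (v, 0), fun u v h => (Prod.mk.inj h).1⟩ with hT
  have hTcard : #T = #Tm := card_map _
  set U : Finset (V × ℝ) := T ∪ (univ.image tl ∪ univ.image hd) with hU
  have hTU : T ∩ U = T := inter_eq_left.2 subset_union_left
  have hmemT : ∀ v ∈ Tm, ((v, 0) : V × ℝ) ∈ T ∩ U := fun v hv => by
    rw [hTU]
    exact mem_map.2 ⟨v, hv, rfl⟩
  have htlU : ∀ a, tl a ∈ U := fun a => by simp [hU]
  have hhdU : ∀ a, hd a ∈ U := fun a => by simp [hU]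
  have hdE : ∀ e, d (tl (.inr (.inr e))) (hd (.inr (.inr e))) = 0 := by
    intro e
    refine max_eq_left ?_
    simp only [htl, hhd, lineTail, lineHead]
    linarith [hlen e]
  have hvol : ∑ a, c a * d (tl a) (hd a) ≤ ω := by
    refine le_trans (le_of_eq ?_) hcost
    have hE : ∑ e : E, c (.inr (.inr e)) * d (tl (.inr (.inr e))) (hd (.inr (.inr e))) = 0 :=
      sum_eq_zero fun e _ => by rw [hdE, mul_zero]
    rw [Fintype.sum_sum_type, Fintype.sum_sum_type, Fintype.sum_prod_type, Fintype.sum_prod_type,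
      hE, add_zero, ← sum_add_distrib]
    refine sum_congr rfl fun v _ => ?_
    rw [← sum_add_distrib]
    refine sum_congr rfl fun j _ => ?_
    have hj : 0 ≤ θ (j + 1) - θ j := sub_nonneg.2 (hθmono (Nat.le_succ _))
    have e1 : d (tl (.inl (v, j))) (hd (.inl (v, j))) = θ (j + 1) - θ j := by
      simp only [hddef, htl, hhd, lineTail, lineHead, hself, zero_add]
      exact max_eq_right hj
    have e2 : d (tl (.inr (.inl (v, j)))) (hd (.inr (.inl (v, j)))) = θ (j + 1) - θ j := by
      simp only [hddef, htl, hhd, lineTail, lineHead, hself, zero_add]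
      rw [max_eq_right (by linarith)]
      ring
    rw [e1, e2]
    simp only [hcdef, lineCap]
    ring
  have hpv : partVolume tl hd c d T (ω / #Tm) U ≤ 2 * ω := by
    simp only [partVolume, htlU, hhdU, and_self, if_true, hTU, hTcard]
    rw [div_mul_cancel₀ _ hm.ne']
    linarith
  obtain ⟨h, h0, hz, hsum, hπ⟩ := hasHeights_of_partVolume_le (T := T) (σ := ω / #Tm) hc
    (fun x y => le_max_left _ _)
    (fun x => by simp [hself])
    (fun x y z => by
      have := htri x.1 y.1 z.1
      refine max_le (add_nonneg (le_max_left _ _) (le_max_left _ _)) ?_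
      have h1 := le_max_right 0 (dist x.1 y.1 + y.2 - x.2)
      have h2 := le_max_right 0 (dist y.1 z.1 + z.2 - y.2)
      linarith)
    (div_pos hω hm) hL U (hpv.trans (by
      rw [mul_div_assoc', le_div_iff₀ hm]
      have : (2 * #Tm : ℝ) ≤ 2 ^ L := by exact_mod_cast hTL
      nlinarith))
  simp only [htlU, hhdU, and_self, if_true, hTU, hTcard] at hsum
  have hlayer := sum_mul_le_sum_mul_of_layers (fun i => κ * D i)
    (fun i => dist (s i) (t i) + dist (t i) (s i)) c h (fun i => add_nonneg (hd0 _ _) (hd0 _ _)) h0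
    fun τ hτ => by
      obtain ⟨π, hmono, hsep⟩ := hπ τ hτ
      refine le_trans ?_ (N.cutCost_heightCut_le M p q h τ)
      refine le_trans ?_ (H _)
      have hle := N.le_of_isWalk_of_notMem_heightCut hθ hp hq (h := h) (τ := τ)
        (fun e => by rw [hz _ (hdE e)]; exact hτ) (π := π)
        fun a ha => hmono a (htlU a) (hhdU a) ha
      simp only [← mul_ite_zero, ← mul_sum]
      refine mul_le_mul_of_nonneg_left ?_ hκ
      rw [sepDemandSym, sepDemand, Fintype.sum_sum_type, ← sum_add_distrib]
      refine sum_le_sum fun i _ => ?_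
      change (if τ ≤ dist (s i) (t i) + dist (t i) (s i) then D i else 0) ≤
        (if N.Separates (N.heightCut M p q h τ) (s i) (t i) then D i else 0) +
          if N.Separates (N.heightCut M p q h τ) (t i) (s i) then D i else 0
      have hne : τ ≤ dist (s i) (t i) + dist (t i) (s i) →
          N.Separates (N.heightCut M p q h τ) (s i) (t i) ∨
          N.Separates (N.heightCut M p q h τ) (t i) (s i) := by
        intro hdist
        by_contra! hcon
        simp only [Separates, not_not] at hcon
        obtain ⟨⟨l₁, hw₁, hl₁⟩, l₂, hw₂, hl₂⟩ := hcon
        refine hsep (s i, 0) (hmemT _ (hs i)) (t i, 0) (hmemT _ (ht i)) ?_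
          (le_antisymm (hle _ _ _ hw₁ hl₁) (hle _ _ _ hw₂ hl₂))
        refine hdist.trans (add_le_add ?_ ?_) <;> simp
      have hite : ∀ P : Prop, 0 ≤ if P then D i else 0 := fun P => by
        split_ifs
        exacts [hD i, le_rfl]
      by_cases hdist : τ ≤ dist (s i) (t i) + dist (t i) (s i)
      · rw [if_pos hdist]
        rcases hne hdist with hs' | ht'
        · rw [if_pos hs']
          exact le_add_of_nonneg_right (hite _)
        · rw [if_pos ht']
          exact le_add_of_nonneg_left (hite _)
      · rw [if_neg hdist]
        exact add_nonneg (hite _) (hite _)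
  simp only [mul_assoc, ← mul_sum] at hlayer
  refine hlayer.trans (hsum.trans ?_)
  calc _ ≤ 8 * (L : ℝ) * Nat.log 2 #Tm * (2 * ω) := by gcongr
    _ = _ := by ring

end DirPolyNet

theorem LinearMap.apply_eq_sum_single_mul {K : Type*} [Fintype K] [DecidableEq K]
    (G : (K → ℝ) →ₗ[ℝ] ℝ) (v : K → ℝ) : G v = ∑ k, G (Pi.single k 1) * v k := by
  conv_lhs => rw [pi_eq_sum_univ' v, map_sum]
  simp [Pi.single, mul_comm]

/-- Separation of a right-hand side `r` from the routable rate vectors of a flow problem with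
finitely many paths `i : I`, of commodity `com i` and edge set `edges i`, whose edge flow is
constrained to two compact convex down-closed sets. -/
theorem exists_separating_lengths {I J E : Type*} [Fintype I] [Fintype J] [Fintype E]
    [DecidableEq E]
    (com : I → J) (edges : I → Finset E) {P Q : Set (E → ℝ)}
    (hPc : IsCompact P) (hPconv : Convex ℝ P) (hQc : IsCompact Q) (hQconv : Convex ℝ Q)
    (hPdown : ∀ x ∈ P, ∀ A : Finset E, (fun e => if e ∈ A then x e else 0) ∈ P)
    (hQdown : ∀ x ∈ Q, ∀ A : Finset E, (fun e => if e ∈ A then x e else 0) ∈ Q)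
    (r : J → ℝ) (M : ℝ)
    (hinf : ∀ f : I → ℝ, (∀ i, 0 ≤ f i) → (∀ j, (∑ i, if com i = j then f i else 0) = r j) →
      (fun e => ∑ i, if e ∈ edges i then f i else 0) ∈ P →
      (fun e => ∑ i, if e ∈ edges i then f i else 0) ∈ Q → False) :
    ∃ (w : J → ℝ) (a b : E → ℝ), (∀ e, 0 ≤ a e) ∧ (∀ e, 0 ≤ b e) ∧
      ∀ f : I → ℝ, (∀ i, 0 ≤ f i) → (∀ i, f i ≤ M) → ∀ x ∈ P, ∀ y ∈ Q,
        ∑ i, f i * (w (com i) - ∑ e ∈ edges i, (a e + b e)) + ∑ e, a e * x e + ∑ e, b e * y e <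
          ∑ j, w j * r j := by
  set rt : (I → ℝ) → J → ℝ := fun f j => ∑ i, if com i = j then f i else 0 with hrt
  set fl : (I → ℝ) → E → ℝ := fun f e => ∑ i, if e ∈ edges i then f i else 0 with hfl
  set Φ : (I → ℝ) × (E → ℝ) × (E → ℝ) → (J → ℝ) × (E → ℝ) × (E → ℝ) :=
    fun z => (rt z.1, z.2.1 - fl z.1, z.2.2 - fl z.1) with hΦ
  have hrtadd : ∀ f g, rt (f + g) = rt f + rt g := fun f g => by
    ext j
    simp only [hrt, Pi.add_apply, ← sum_add_distrib]
    exact sum_congr rfl fun i _ => by split_ifs <;> simp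
  have hfladd : ∀ f g, fl (f + g) = fl f + fl g := fun f g => by
    ext j
    simp only [hfl, Pi.add_apply, ← sum_add_distrib]
    exact sum_congr rfl fun i _ => by split_ifs <;> simp
  have hrtsmul : ∀ (c : ℝ) f, rt (c • f) = c • rt f := fun c f => by
    ext j
    simp [hrt, mul_sum]
  have hflsmul : ∀ (c : ℝ) f, fl (c • f) = c • fl f := fun c f => by
    ext j
    simp [hfl, mul_sum]
  have hlin : IsLinearMap ℝ Φ := by
    refine ⟨fun z z' => ?_, fun c z => ?_⟩
    · simp only [hΦ, Prod.fst_add, Prod.snd_add, hrtadd, hfladd, Prod.mk_add_mk,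
        add_sub_add_comm]
    · simp only [hΦ, Prod.smul_fst, Prod.smul_snd, hrtsmul, hflsmul, Prod.smul_mk, smul_sub]
  have hcont : Continuous Φ := by
    have h1 : Continuous rt := continuous_pi fun j => continuous_finsetSum _ fun i _ => by
      split_ifs <;> fun_prop
    have h2 : Continuous fl := continuous_pi fun j => continuous_finsetSum _ fun i _ => by
      split_ifs <;> fun_prop
    fun_prop
  set S := Φ '' (Set.Icc 0 (fun _ => M) ×ˢ P ×ˢ Q)
  have hSconv : Convex ℝ S := ((convex_Icc _ _).prod (hPconv.prod hQconv)).is_linear_image hlin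
  have hSclosed : IsClosed S := ((isCompact_Icc.prod (hPc.prod hQc)).image hcont).isClosed
  have hrS : ((r, 0, 0) : (J → ℝ) × (E → ℝ) × (E → ℝ)) ∉ S := by
    rintro ⟨⟨f, x, y⟩, ⟨hf, hx, hy⟩, heq⟩
    simp only [hΦ, Prod.mk.injEq, sub_eq_zero] at heq
    obtain ⟨h1, rfl, rfl⟩ := heq
    exact hinf f hf.1 (fun j => congrFun h1 j) hx hy
  obtain ⟨g, u, hgS, hgr⟩ := geometric_hahn_banach_closed_point hSconv hSclosed hrS
  set w : J → ℝ := fun j => g (Pi.single j 1, 0, 0) with hw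
  set a : E → ℝ := fun e => g (0, Pi.single e 1, 0) with ha
  set b : E → ℝ := fun e => g (0, 0, Pi.single e 1) with hb
  have hg : ∀ v x y, g (v, x, y) = ∑ j, w j * v j + ∑ e, a e * x e + ∑ e, b e * y e := by
    intro v x y
    have h1 := (g.toLinearMap ∘ₗ
      LinearMap.inl ℝ (J → ℝ) ((E → ℝ) × (E → ℝ))).apply_eq_sum_single_mul v
    have h2 := (g.toLinearMap ∘ₗ LinearMap.inr ℝ (J → ℝ) ((E → ℝ) × (E → ℝ)) ∘ₗ
      LinearMap.inl ℝ (E → ℝ) (E → ℝ)).apply_eq_sum_single_mul x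
    have h3 := (g.toLinearMap ∘ₗ LinearMap.inr ℝ (J → ℝ) ((E → ℝ) × (E → ℝ)) ∘ₗ
      LinearMap.inr ℝ (E → ℝ) (E → ℝ)).apply_eq_sum_single_mul y
    have hsplit : ((v, x, y) : (J → ℝ) × (E → ℝ) × (E → ℝ)) =
        (v, 0, 0) + (0, x, 0) + (0, 0, y) := by simp
    rw [hsplit, map_add, map_add]
    exact congrArg₂ _ (congrArg₂ _ h1 h2) h3
  refine ⟨w, fun e => max (a e) 0, fun e => max (b e) 0, fun e => le_max_right _ _,
    fun e => le_max_right _ _, fun f hf hfM x hx y hy => ?_⟩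
  set x' : E → ℝ := fun e => if e ∈ univ.filter (fun e => 0 ≤ a e) then x e else 0 with hx'
  set y' : E → ℝ := fun e => if e ∈ univ.filter (fun e => 0 ≤ b e) then y e else 0 with hy'
  have hlt := (hgS (Φ (f, x', y')) ⟨_, ⟨⟨hf, hfM⟩, hPdown x hx _, hQdown y hy _⟩, rfl⟩).trans hgr
  rw [hΦ, hg, hg] at hlt
  simp only [Pi.zero_apply, mul_zero, sum_const_zero, add_zero, Pi.sub_apply, mul_sub,
    sum_sub_distrib] at hlt
  have hax : ∑ e, max (a e) 0 * x e = ∑ e, a e * x' e := sum_congr rfl fun e _ => by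
    by_cases h : 0 ≤ a e
    · simp [hx', h]
    · simp [hx', h, max_eq_right (not_le.1 h).le]
  have hby : ∑ e, max (b e) 0 * y e = ∑ e, b e * y' e := sum_congr rfl fun e _ => by
    by_cases h : 0 ≤ b e
    · simp [hy', h]
    · simp [hy', h, max_eq_right (not_le.1 h).le]
  have hwr : ∑ j, w j * rt f j = ∑ i, f i * w (com i) := by
    simp only [hrt, mul_sum]
    rw [sum_comm]
    exact sum_congr rfl fun i _ => by simp [mul_comm]
  have hswap : ∀ c : E → ℝ, ∑ i, f i * ∑ e ∈ edges i, c e = ∑ e, c e * fl f e := by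
    intro c
    simp only [hfl, mul_sum]
    rw [sum_comm]
    refine sum_congr rfl fun i _ => ?_
    simp [mul_comm]
  have hfl0 : ∀ e, 0 ≤ fl f e := fun e => sum_nonneg fun i _ => by
    split_ifs
    exacts [hf i, le_rfl]
  have hmono : ∑ e, a e * fl f e + ∑ e, b e * fl f e ≤
      ∑ e, (max (a e) 0 + max (b e) 0) * fl f e := by
    rw [← sum_add_distrib]
    refine sum_le_sum fun e _ => ?_
    rw [← add_mul]
    exact mul_le_mul_of_nonneg_right (add_le_add (le_max_left _ _) (le_max_left _ _)) (hfl0 e)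
  simp only [mul_sub, sum_sub_distrib]
  rw [hswap, hax, hby, ← hwr]
  linarith

namespace DirPolyNet

variable {V E : Type} [Fintype V] [Fintype E] [DecidableEq V] [DecidableEq E]
  {N : DirPolyNet V E}

theorem length_walkVerts (u : V) (l : List E) : (N.walkVerts u l).length = l.length + 1 := by
  induction l generalizing u with
  | nil => rfl
  | cons e l ih => simp [walkVerts, ih]

theorem IsPath.length_lt {u v : V} {l : List E} (h : N.IsPath u v l) :
    l.length < Fintype.card V := by
  have := h.2.length_le_card
  rw [length_walkVerts] at this
  omega

theorem IsWalk.append {u v w : V} {l l' : List E} (h : N.IsWalk u v l) (h' : N.IsWalk v w l') :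
    N.IsWalk u w (l ++ l') := by
  induction l generalizing u with
  | nil => rwa [show u = v from h]
  | cons e l ih => exact ⟨h.1, ih h.2⟩

theorem IsPath.exists_suffix {u v w : V} {l : List E} (h : N.IsPath u v l)
    (hw : w ∈ N.walkVerts u l) : ∃ l', N.IsPath w v l' ∧ l' ⊆ l := by
  induction l generalizing u with
  | nil =>
    obtain rfl : w = u := by simpa [walkVerts] using hw
    exact ⟨[], h, fun _ => id⟩
  | cons e l ih =>
    obtain ⟨⟨rfl, hwalk⟩, hnd⟩ := h
    rw [walkVerts] at hw hnd
    rcases List.mem_cons.1 hw with rfl | hw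
    · exact ⟨e :: l, ⟨⟨rfl, hwalk⟩, hnd⟩, fun _ => id⟩
    · obtain ⟨l', h1, h2⟩ := ih ⟨hwalk, (List.nodup_cons.1 hnd).2⟩ hw
      exact ⟨l', h1, fun _ hx => List.mem_cons_of_mem _ (h2 hx)⟩

theorem IsWalk.exists_isPath {u v : V} {l : List E} (h : N.IsWalk u v l) :
    ∃ l', N.IsPath u v l' ∧ l' ⊆ l := by
  induction l generalizing u with
  | nil => exact ⟨[], ⟨h, by simp [walkVerts]⟩, fun _ => id⟩
  | cons e l ih =>
    obtain ⟨rfl, hwalk⟩ := h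
    obtain ⟨q, hq, hql⟩ := ih hwalk
    by_cases hmem : N.tail e ∈ N.walkVerts (N.head e) q
    · obtain ⟨l', h1, h2⟩ := hq.exists_suffix hmem
      exact ⟨l', h1, fun _ hx => List.mem_cons_of_mem _ (hql (h2 hx))⟩
    · exact ⟨e :: q, ⟨⟨rfl, hq.1⟩, List.nodup_cons.2 ⟨hmem, hq.2⟩⟩, List.cons_subset_cons _ hql⟩

/-- Truncated shortest path distances with respect to the edge lengths `ℓ`. -/
theorem exists_truncated_dist (N : DirPolyNet V E) {ℓ : E → ℝ} (hℓ : ∀ e, 0 ≤ ℓ e) {R : ℝ}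
    (hR : 0 ≤ R) :
    ∃ dist : V → V → ℝ, (∀ u v, 0 ≤ dist u v) ∧ (∀ u, dist u u = 0) ∧
      (∀ u v w, dist u w ≤ dist u v + dist v w) ∧ (∀ e, dist (N.tail e) (N.head e) ≤ ℓ e) ∧
      ∀ u v K, K ≤ R → (∀ l, N.IsPath u v l → K ≤ ∑ e ∈ l.toFinset, ℓ e) → K ≤ dist u v := by
  set S : V → V → Set ℝ := fun u v =>
    {c | R ≤ c ∨ ∃ l, N.IsWalk u v l ∧ ∑ e ∈ l.toFinset, ℓ e ≤ c} with hS
  have hnn : ∀ u v, ∀ c ∈ S u v, 0 ≤ c := by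
    rintro u v c (hc | ⟨l, -, hc⟩)
    exacts [hR.trans hc, (sum_nonneg fun e _ => hℓ e).trans hc]
  have hne : ∀ u v, (S u v).Nonempty := fun u v => ⟨R, .inl le_rfl⟩
  have hle : ∀ u v, ∀ c ∈ S u v, sInf (S u v) ≤ c := fun u v c hc =>
    csInf_le ⟨0, fun c hc => hnn u v c hc⟩ hc
  refine ⟨fun u v => sInf (S u v), fun u v => Real.sInf_nonneg (hnn u v), fun u => ?_,
    fun u v w => ?_, fun e => ?_, fun u v K hK hpath => ?_⟩
  · exact le_antisymm (hle u u 0 (.inr ⟨[], rfl, by simp⟩)) (Real.sInf_nonneg (hnn u u))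
  · have key : ∀ c ∈ S u v, ∀ c' ∈ S v w, sInf (S u w) ≤ c + c' := by
      intro c hc c' hc'
      refine hle u w _ ?_
      have h0 := hnn u v c hc
      have h0' := hnn v w c' hc'
      rcases hc with hc | ⟨l, hl, hc⟩
      · exact .inl (by linarith)
      rcases hc' with hc' | ⟨l', hl', hc'⟩
      · exact .inl (by linarith)
      refine .inr ⟨l ++ l', hl.append hl', ?_⟩
      rw [List.toFinset_append]
      have := sum_union_inter (s₁ := l.toFinset) (s₂ := l'.toFinset) (f := ℓ)
      have := sum_nonneg fun e (_ : e ∈ l.toFinset ∩ l'.toFinset) => hℓ e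
      linarith
    have h1 : ∀ c' ∈ S v w, sInf (S u w) - c' ≤ sInf (S u v) := fun c' hc' =>
      le_csInf (hne u v) fun c hc => by linarith [key c hc c' hc']
    have h2 : sInf (S u w) - sInf (S u v) ≤ sInf (S v w) :=
      le_csInf (hne v w) fun c' hc' => by linarith [h1 c' hc']
    linarith
  · exact hle _ _ _ (.inr ⟨[e], ⟨rfl, rfl⟩, by simp⟩)
  · refine le_csInf (hne u v) ?_
    rintro c (hc | ⟨l, hl, hc⟩)
    · exact hK.trans hc
    · obtain ⟨q, hq, hql⟩ := hl.exists_isPath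
      refine (hpath q hq).trans (le_trans ?_ hc)
      refine sum_le_sum_of_subset_of_nonneg ?_ fun e _ _ => hℓ e
      intro e he
      simp only [List.mem_toFinset] at he ⊢
      exact hql he

end DirPolyNet

/-- The vectors of edge loads allowed by the set functions `ρ v` on the fibres of `en`. -/
def loadPolytope {V E : Type*} [DecidableEq V] [Fintype E] (en : E → V) (ρ : V → Finset E → ℝ) :
    Set (E → ℝ) :=
  {x | (∀ e, 0 ≤ x e) ∧ ∀ v, ∀ S ⊆ univ.filter (fun e => en e = v), ∑ e ∈ S, x e ≤ ρ v S}

section LoadPolytope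

variable {V E : Type*} [DecidableEq V] [Fintype E] {en : E → V} {ρ : V → Finset E → ℝ}

theorem isCompact_loadPolytope : IsCompact (loadPolytope en ρ) := by
  refine (isCompact_Icc (a := (0 : E → ℝ)) (b := fun e => ρ (en e) {e})).of_isClosed_subset ?_ ?_
  · simp only [loadPolytope, Set.ofPred_and, Set.ofPred_forall]
    refine IsClosed.inter (isClosed_iInter fun e => isClosed_le (by fun_prop) (by fun_prop)) ?_
    exact isClosed_iInter fun v => isClosed_iInter fun S => isClosed_iInter fun _ =>
      isClosed_le (continuous_finsetSum _ fun e _ => continuous_apply e) (by fun_prop)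
  · refine fun x hx => ⟨hx.1, fun e => ?_⟩
    simpa using hx.2 (en e) {e} (by simp)

theorem convex_loadPolytope : Convex ℝ (loadPolytope en ρ) := by
  intro x hx y hy a b ha hb hab
  refine ⟨fun e => add_nonneg (mul_nonneg ha (hx.1 e)) (mul_nonneg hb (hy.1 e)), fun v S hS => ?_⟩
  simp only [Pi.add_apply, Pi.smul_apply, smul_eq_mul, sum_add_distrib, ← mul_sum]
  have h1 := mul_le_mul_of_nonneg_left (hx.2 v S hS) ha
  have h2 := mul_le_mul_of_nonneg_left (hy.2 v S hS) hb
  calc _ ≤ a * ρ v S + b * ρ v S := add_le_add h1 h2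
    _ = ρ v S := by rw [← add_mul, hab, one_mul]

theorem loadPolytope_mono {x y : E → ℝ} (hy : y ∈ loadPolytope en ρ) (hx : ∀ e, 0 ≤ x e)
    (hxy : ∀ e, x e ≤ y e) : x ∈ loadPolytope en ρ :=
  ⟨hx, fun v S hS => (sum_le_sum fun e _ => hxy e).trans (hy.2 v S hS)⟩

theorem ite_mem_loadPolytope [DecidableEq E] {x : E → ℝ} (hx : x ∈ loadPolytope en ρ)
    (A : Finset E) :
    (fun e => if e ∈ A then x e else 0) ∈ loadPolytope en ρ := by
  refine loadPolytope_mono hx (fun e => ?_) fun e => ?_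
  · split_ifs
    exacts [hx.1 e, le_rfl]
  · split_ifs
    exacts [le_rfl, hx.1 e]

theorem zero_mem_loadPolytope (h : ∀ v, ∀ S ⊆ univ.filter (fun e => en e = v), 0 ≤ ρ v S) :
    (0 : E → ℝ) ∈ loadPolytope en ρ :=
  ⟨fun _ => le_rfl, fun v S hS => by simpa using h v S hS⟩

end LoadPolytope

namespace DirPolyNet

variable {V E : Type} [Fintype V] [Fintype E] [DecidableEq V] [DecidableEq E]
  (N : DirPolyNet V E)

/-- A finite index set for all simple paths of all commodities. -/
noncomputable def pathIndex {ι : Type} [Fintype ι] (s t : ι → V) : Finset (ι × List E) :=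
  (univ ×ˢ (List.finite_length_lt E (Fintype.card V)).toFinset).filter fun z =>
    N.IsPath (s z.1) (t z.1) z.2

variable {N} {ι : Type} [Fintype ι] {s t : ι → V}

theorem mem_pathIndex {z : ι × List E} :
    z ∈ N.pathIndex s t ↔ N.IsPath (s z.1) (t z.1) z.2 := by
  simp only [pathIndex, mem_filter, mem_product, mem_univ, true_and, Set.Finite.mem_toFinset,
    Set.mem_ofPred_eq, and_iff_right_iff_imp]
  exact fun h => h.length_lt

theorem exists_isFlow_of_load_mem (f : N.pathIndex s t → ℝ) (hf : ∀ i, 0 ≤ f i)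
    (hP : (fun e => ∑ i, if e ∈ i.1.2.toFinset then f i else 0) ∈ loadPolytope N.tail N.rhoP)
    (hM : (fun e => ∑ i, if e ∈ i.1.2.toFinset then f i else 0) ∈ loadPolytope N.head N.rhoM) :
    ∃ f', N.IsFlow s t f' ∧ ∀ j, rate f' j = ∑ i, if i.1.1 = j then f i else 0 := by
  set f' : ι → List E → ℝ := fun j l => if h : (j, l) ∈ N.pathIndex s t then f ⟨_, h⟩ else 0
    with hf'
  have hf'i : ∀ i : N.pathIndex s t, f' i.1.1 i.1.2 = f i := fun i => by simp [hf']
  have hsupp : ∀ j l, f' j l ≠ 0 → (j, l) ∈ N.pathIndex s t := by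
    intro j l h
    by_contra hn
    exact h (dif_neg hn)
  set B := (List.finite_length_lt E (Fintype.card V)).toFinset with hB
  have hBmem : ∀ j l, f' j l ≠ 0 → l ∈ B := fun j l h => by
    simpa [hB] using (mem_pathIndex.1 (hsupp j l h)).length_lt
  have hsum : ∀ (A : ι × List E → Prop) [DecidablePred A],
      (∑ i : N.pathIndex s t, if A i then f i else 0) =
      ∑ j, ∑ l ∈ B, if A (j, l) then f' j l else 0 := by
    intro A _
    rw [← sum_product' (f := fun j l => if A (j, l) then f' j l else 0)]
    calc _ = ∑ i : N.pathIndex s t, if A i then f' i.1.1 i.1.2 else 0 := by simp only [hf'i]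
      _ = ∑ z ∈ N.pathIndex s t, if A z then f' z.1 z.2 else 0 :=
        sum_coe_sort _ fun z : ι × List E => if A z then f' z.1 z.2 else 0
      _ = _ := by
        refine sum_subset (filter_subset _ _) fun z _ hz => ?_
        simp [hf', hz]
  have hedge : ∀ e, N.edgeFlow f' e = ∑ i, if e ∈ i.1.2.toFinset then f i else 0 := by
    intro e
    rw [hsum fun z => e ∈ z.2.toFinset]
    refine sum_congr rfl fun j _ => ?_
    rw [finsum_mem_def, finsum_eq_sum_of_support_subset (s := B)]
    · refine sum_congr rfl fun l _ => ?_
      simp [Set.indicator_apply]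
    · intro l hl
      refine hBmem j l fun h => hl ?_
      simp [Set.indicator_apply, h]
  refine ⟨f', ⟨fun j l => ?_, fun j l h => mem_pathIndex.1 (hsupp j l h), fun j => ?_, ?_, ?_⟩,
    fun j => ?_⟩
  · simp only [hf']
    split_ifs
    exacts [hf _, le_rfl]
  · exact B.finite_toSet.subset fun l hl => hBmem j l hl
  · intro v S hS
    simpa only [hedge] using hM.2 v S hS
  · intro v S hS
    simpa only [hedge] using hP.2 v S hS
  · rw [hsum fun z => z.1 = j, rate, finsum_eq_sum_of_support_subset (s := B)]
    · rw [sum_eq_single j (fun j' _ hj' => by simp [hj']) (by simp)]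
      simp
    · exact fun l hl => hBmem j l hl

/-- Linear programming duality: if rates `β * D j` cannot be routed, then some edge lengths, split
between tails and heads, place the demand pairs far apart at a small cost. -/
theorem exists_lengths_of_not_exists_isFlow {D : ι → ℝ} (hD : ∀ j, 0 ≤ D j) {β : ℝ} (hβ : 0 < β)
    (hinf : ¬ ∃ f, N.IsFlow s t f ∧ ∀ j, rate f j = β * D j) :
    ∃ (a b : E → ℝ) (dist : V → V → ℝ), (∀ e, 0 ≤ a e) ∧ (∀ e, 0 ≤ b e) ∧
      (∀ u v, 0 ≤ dist u v) ∧ (∀ u, dist u u = 0) ∧ (∀ u v w, dist u w ≤ dist u v + dist v w) ∧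
      (∀ e, dist (N.tail e) (N.head e) ≤ a e + b e) ∧ 0 < ∑ j, D j * dist (s j) (t j) ∧
      ∀ x ∈ loadPolytope N.tail N.rhoP, ∀ y ∈ loadPolytope N.head N.rhoM,
        ∑ e, a e * x e + ∑ e, b e * y e ≤ 2 * β * ∑ j, D j * dist (s j) (t j) := by
  set M : ℝ := 2 * (∑ j, D j) * β + 1 with hM
  have hsD : 0 ≤ ∑ j, D j := sum_nonneg fun j _ => hD j
  have hM0 : 0 < M := by positivity
  obtain ⟨w, a, b, ha, hb, hsep⟩ := exists_separating_lengths
    (fun i : N.pathIndex s t => i.1.1) (fun i => i.1.2.toFinset)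
    (isCompact_loadPolytope (en := N.tail) (ρ := N.rhoP)) convex_loadPolytope
    (isCompact_loadPolytope (en := N.head) (ρ := N.rhoM)) convex_loadPolytope
    (fun x hx A => ite_mem_loadPolytope hx A) (fun x hx A => ite_mem_loadPolytope hx A)
    (fun j => β * D j) M fun f hf hr hP hQ => hinf <| by
      obtain ⟨f', h1, h2⟩ := exists_isFlow_of_load_mem f hf hP hQ
      exact ⟨f', h1, fun j => (h2 j).trans (hr j)⟩
  have h0P := zero_mem_loadPolytope N.rhoP_nonneg
  have h0M := zero_mem_loadPolytope N.rhoM_nonneg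
  obtain ⟨R, hR0, hR⟩ : ∃ R, 0 ≤ R ∧ ∀ j, w j ≤ R :=
    ⟨∑ j, |w j|, sum_nonneg fun j _ => abs_nonneg _, fun j => (le_abs_self _).trans
      (single_le_sum (f := fun j => |w j|) (fun j _ => abs_nonneg _) (mem_univ j))⟩
  obtain ⟨dist, hd0, hself, htri, hlen, hfar⟩ :=
    N.exists_truncated_dist (ℓ := fun e => a e + b e) (fun e => add_nonneg (ha e) (hb e)) hR0
  set gap : N.pathIndex s t → ℝ := fun i =>
    max 0 (w i.1.1 - ∑ e ∈ i.1.2.toFinset, (a e + b e)) with hgap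
  have hgap0 : ∀ i, 0 ≤ gap i := fun i => le_max_left _ _
  have hgapsum : M * ∑ i, gap i < β * ∑ j, w j * D j := by
    have := hsep (fun i => if 0 ≤ w i.1.1 - ∑ e ∈ i.1.2.toFinset, (a e + b e) then M else 0)
      (fun i => by split_ifs; exacts [hM0.le, le_rfl])
      (fun i => by split_ifs; exacts [le_rfl, hM0.le]) 0 h0P 0 h0M
    simp only [Pi.zero_apply, mul_zero, sum_const_zero, add_zero] at this
    rw [mul_sum, mul_sum]
    convert this using 1
    · refine sum_congr rfl fun i _ => ?_
      by_cases h : 0 ≤ w i.1.1 - ∑ e ∈ i.1.2.toFinset, (a e + b e)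
      · simp only [hgap, if_pos h, max_eq_right h]
      · simp only [hgap, if_neg h, max_eq_left (not_le.1 h).le, mul_zero, zero_mul]
    · exact sum_congr rfl fun j _ => by ring
  have hG0 : 0 ≤ ∑ i, gap i := sum_nonneg fun i _ => hgap0 i
  have hwD : 0 < ∑ j, w j * D j := by
    by_contra! h
    nlinarith [mul_nonneg hM0.le hG0]
  have hdist : ∀ j, w j - ∑ i, gap i ≤ dist (s j) (t j) := by
    intro j
    refine hfar _ _ _ (by linarith [hR j]) fun l hl => ?_
    have h1 := single_le_sum (f := gap) (fun i _ => hgap0 i)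
      (mem_univ (⟨(j, l), mem_pathIndex.2 hl⟩ : N.pathIndex s t))
    have h2 := le_max_right 0 (w j - ∑ e ∈ l.toFinset, (a e + b e))
    linarith
  have hΔ : (∑ j, w j * D j) ≤ 2 * ∑ j, D j * dist (s j) (t j) := by
    have h1 : ∑ j, (w j * D j - D j * ∑ i, gap i) ≤ ∑ j, D j * dist (s j) (t j) :=
      sum_le_sum fun j _ => by nlinarith [mul_le_mul_of_nonneg_left (hdist j) (hD j)]
    rw [sum_sub_distrib, ← sum_mul] at h1
    have h2 : 2 * ((∑ j, D j) * ∑ i, gap i) ≤ ∑ j, w j * D j := by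
      refine le_of_mul_le_mul_left ?_ hβ
      rw [hM] at hgapsum
      nlinarith
    linarith
  refine ⟨a, b, dist, ha, hb, hd0, hself, htri, hlen, by linarith, fun x hx y hy => ?_⟩
  have h1 := hsep (fun _ => 0) (fun _ => le_rfl) (fun _ => hM0.le) x hx y hy
  have h2 : ∑ j, w j * (β * D j) = β * ∑ j, w j * D j := by
    rw [mul_sum]
    exact sum_congr rfl fun j _ => by ring
  simp only [zero_mul, sum_const_zero, zero_add, h2] at h1
  nlinarith

end DirPolyNet

theorem sum_range_level_sub {θ : ℕ → ℝ} (hθ : θ 0 = 0) {M n : ℕ} (hn : n ≤ M) :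
    (∑ j : Fin M, if (j : ℕ) + 1 ≤ n then θ (j + 1) - θ j else 0) = θ n := by
  rw [Fin.sum_univ_eq_sum_range (fun j => if j + 1 ≤ n then θ (j + 1) - θ j else 0), ← sum_filter]
  have : (range M).filter (fun j => j + 1 ≤ n) = range n := by
    ext j
    simp only [mem_filter, mem_range]
    omega
  rw [this, sum_range_sub, hθ, sub_zero]

/-- Some load vector attains the layered cost of the edge lengths `θ (p e)`. -/
theorem exists_load_eq_sum_levels {V E : Type*} [Fintype V] [DecidableEq V] [Fintype E]
    [DecidableEq E] {en : E → V} {ρ : V → Finset E → ℝ} (hempty : ∀ v, ρ v ∅ = 0)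
    (hmono : ∀ v A B, A ⊆ B → B ⊆ univ.filter (fun e => en e = v) → ρ v A ≤ ρ v B)
    (hsub : ∀ v A B, A ⊆ univ.filter (fun e => en e = v) → B ⊆ univ.filter (fun e => en e = v) →
      ρ v (A ∪ B) + ρ v (A ∩ B) ≤ ρ v A + ρ v B)
    {θ : ℕ → ℝ} (hθ : θ 0 = 0) {M : ℕ} {p : E → ℕ} (hp : ∀ e, p e ≤ M) :
    ∃ x ∈ loadPolytope en ρ, ∑ v, ∑ j : Fin M, (θ (j + 1) - θ j) *
      ρ v ((univ.filter fun e => en e = v).filter fun e => (j : ℕ) + 1 ≤ p e) =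
        ∑ e, θ (p e) * x e := by
  choose x hx0 hxS hxj using fun v =>
    exists_greedy_vector (ρ v) (hempty v) p (univ.filter fun e => en e = v) (hmono v) (hsub v)
  refine ⟨fun e => x (en e) e, ⟨fun e => hx0 _ _, fun v S hS => ?_⟩, ?_⟩
  · refine le_trans (le_of_eq (sum_congr rfl fun e he => ?_)) (hxS v S hS)
    have h : en e = v := (mem_filter.1 (hS he)).2
    subst h
    rfl
  · calc _ = ∑ v, ∑ j : Fin M, ∑ e, if en e = v ∧ (j : ℕ) + 1 ≤ p e then
          (θ (j + 1) - θ j) * x (en e) e else 0 := by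
          refine sum_congr rfl fun v _ => sum_congr rfl fun j _ => ?_
          rw [← hxj v, filter_filter, mul_sum, sum_filter]
          refine sum_congr rfl fun e _ => ?_
          split_ifs with h
          · rw [h.1]
          · rfl
      _ = ∑ e, ∑ j : Fin M, ∑ v, if en e = v ∧ (j : ℕ) + 1 ≤ p e then
          (θ (j + 1) - θ j) * x (en e) e else 0 := by
          rw [sum_comm, sum_congr rfl fun j _ => sum_comm, sum_comm]
      _ = _ := by
          refine sum_congr rfl fun e _ => ?_
          rw [← sum_range_level_sub hθ (hp e), sum_mul]
          refine sum_congr rfl fun j _ => ?_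
          simp [ite_and]

namespace DirPolyNet

variable {V E : Type} [Fintype V] [Fintype E] [DecidableEq V] [DecidableEq E]
  {N : DirPolyNet V E}

theorem IsFlow.rate_le {ι : Type} [Fintype ι] {s t : ι → V} {f : ι → List E → ℝ}
    (hf : N.IsFlow s t f) {j : ι} (hst : s j ≠ t j) :
    rate f j ≤ ∑ v, N.rhoP v (N.outE v) := by
  have h1 : rate f j ≤ ∑ e, ∑ᶠ l ∈ {l : List E | e ∈ l}, f j l := by
    set B := (hf.fin j).toFinset with hB
    have hBsub : Function.support (f j) ⊆ B := by simp [hB]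
    have h2 : ∀ e, ∑ᶠ l ∈ {l : List E | e ∈ l}, f j l = ∑ l ∈ B, if e ∈ l then f j l else 0 := by
      intro e
      rw [finsum_mem_def, finsum_eq_sum_of_support_subset (s := B)]
      · simp [Set.indicator_apply]
      · intro l hl
        refine hBsub fun h => hl ?_
        simp [Set.indicator_apply, h]
    rw [rate, finsum_eq_sum_of_support_subset _ hBsub]
    simp only [h2]
    rw [sum_comm]
    refine sum_le_sum fun l hl => ?_
    have hl0 : f j l ≠ 0 := by simpa [hB] using hl
    obtain ⟨e, he⟩ : ∃ e, e ∈ l := by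
      refine List.exists_mem_of_ne_nil _ ?_
      rintro rfl
      exact hst (hf.supp j _ hl0).1
    have h3 := single_le_sum (f := fun e => if e ∈ l then f j l else 0)
      (fun e _ => by split_ifs; exacts [hf.nonneg j l, le_rfl]) (mem_univ e)
    simpa [he] using h3
  have h2 : ∀ e, ∑ᶠ l ∈ {l : List E | e ∈ l}, f j l ≤ N.edgeFlow f e := fun e =>
    single_le_sum (f := fun j => ∑ᶠ l ∈ {l : List E | e ∈ l}, f j l)
      (fun i _ => finsum_nonneg fun l => finsum_nonneg fun _ => hf.nonneg i l) (mem_univ j)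
  refine h1.trans ((sum_le_sum fun e _ => h2 e).trans ?_)
  rw [← sum_fiberwise univ N.tail]
  exact sum_le_sum fun v _ => hf.capP v _ subset_rfl

theorem isFlow_zero {ι : Type} [Fintype ι] {s t : ι → V} :
    N.IsFlow s t (0 : ι → List E → ℝ) := by
  have h : ∀ e, N.edgeFlow (0 : ι → List E → ℝ) e = 0 := fun e => by simp [edgeFlow]
  refine ⟨fun _ _ => le_rfl, fun i p hp => absurd rfl hp, fun i => by simp, fun v S hS => ?_,
    fun v S hS => ?_⟩
  · simpa [h] using N.rhoM_nonneg v S hS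
  · simpa [h] using N.rhoP_nonneg v S hS

section Sym

variable {k : ℕ} {s t : Fin k → V} {D : Fin k → ℝ}

theorem bddAbove_concurrentSym (hst : ∀ i, s i ≠ t i) (hDpos : ∃ i, 0 < D i) :
    BddAbove { lam : ℝ | ∃ f : (Fin k ⊕ Fin k) → List E → ℝ,
      N.IsFlow (Sum.elim s t) (Sum.elim t s) f ∧
      ∀ j : Fin k ⊕ Fin k, rate f j = lam * D (Sum.elim id id j) } := by
  obtain ⟨i, hi⟩ := hDpos
  refine ⟨(∑ v, N.rhoP v (N.outE v)) / D i, ?_⟩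
  rintro lam ⟨f, hf, hrate⟩
  rw [le_div_iff₀ hi]
  exact (hrate (.inl i)).symm.le.trans (hf.rate_le (hst i))

theorem maxConcurrentSym_nonneg (hst : ∀ i, s i ≠ t i) (hDpos : ∃ i, 0 < D i) :
    0 ≤ N.maxConcurrentSym s t D :=
  le_csSup (bddAbove_concurrentSym hst hDpos) ⟨0, isFlow_zero, fun j => by simp [rate]⟩

theorem sepDemandSym_nonneg (hD : ∀ i, 0 ≤ D i) (F : Finset E) : 0 ≤ N.sepDemandSym s t D F := by
  rw [sepDemandSym, sepDemand]
  refine sum_nonneg fun j _ => ?_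
  split_ifs
  exacts [hD _, le_rfl]

/-- If concurrent flow value `β` is infeasible, then some cut has sparsity `O(log² m) * β`, where
`m` is the number of terminals. -/
theorem exists_sparse_cut_of_not_exists_isFlow (hD : ∀ i, 0 ≤ D i)
    {Tm : Finset V} (hs : ∀ i, s i ∈ Tm) (ht : ∀ i, t i ∈ Tm) (hTm : 2 ≤ #Tm)
    {L : ℕ} (hTL : 2 * #Tm ≤ 2 ^ L) {β : ℝ} (hβ : 0 < β)
    (hinf : ¬ ∃ f, N.IsFlow (Sum.elim s t) (Sum.elim t s) f ∧
      ∀ j : Fin k ⊕ Fin k, rate f j = β * D (Sum.elim id id j)) :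
    ∃ F, 0 < N.sepDemandSym s t D F ∧
      N.cutCost F / N.sepDemandSym s t D F ≤ 33 * L * Nat.log 2 #Tm * β := by
  obtain ⟨a, b, dist, ha, hb, hd0, hself, htri, hlen, hΔ, hcost⟩ :=
    exists_lengths_of_not_exists_isFlow (fun j => hD _) hβ hinf
  obtain ⟨θ, M, p, hθ, hmono, hpM⟩ := exists_monotone_levels (Sum.elim a b) (by
    rintro (e | e)
    exacts [ha e, hb e])
  have hp : ∀ e, p (.inl e) ≤ M := fun e => (hpM _).1
  have hq : ∀ e, p (.inr e) ≤ M := fun e => (hpM _).1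
  have hpa : ∀ e, θ (p (.inl e)) = a e := fun e => (hpM (.inl e)).2
  have hqb : ∀ e, θ (p (.inr e)) = b e := fun e => (hpM (.inr e)).2
  obtain ⟨x, hx, hxsum⟩ :=
    exists_load_eq_sum_levels N.rhoP_empty N.rhoP_mono N.rhoP_submod hθ hp
  obtain ⟨y, hy, hysum⟩ :=
    exists_load_eq_sum_levels N.rhoM_empty N.rhoM_mono N.rhoM_submod hθ hq
  have hcost' := hcost x hx y hy
  simp only [hpa, hqb] at hxsum hysum
  rw [← hxsum, ← hysum, ← sum_add_distrib] at hcost'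
  simp only [← sum_add_distrib, ← mul_add] at hcost'
  have hL : 0 < L := by
    rcases Nat.eq_zero_or_pos L with rfl | h
    · simp at hTL; omega
    · exact h
  have hlog : 0 < Nat.log 2 #Tm := Nat.log_pos one_lt_two hTm
  have hΔeq : ∑ j : Fin k ⊕ Fin k, D (Sum.elim id id j) *
      dist (Sum.elim s t j) (Sum.elim t s j) =
      ∑ i, D i * (dist (s i) (t i) + dist (t i) (s i)) := by
    simp [Fintype.sum_sum_type, mul_add, sum_add_distrib]
  rw [hΔeq] at hΔ hcost'
  have hTm0 : Tm.Nonempty := card_pos.1 (by omega)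
  by_contra! hcon
  have hK : (0 : ℝ) < 33 * L * Nat.log 2 #Tm * β := by positivity
  have hround := N.mul_sum_dist_le_of_sparsity hD hθ hmono hp hq hd0 hself htri
    (fun e => by rw [hpa, hqb]; exact hlen e) (mul_pos (mul_pos two_pos hβ) hΔ) hcost' hs ht
    hTm0 hL hTL hK.le fun F => by
      rcases (sepDemandSym_nonneg (N := N) (s := s) (t := t) hD F).eq_or_lt with h | h
      · rw [← h, mul_zero]
        exact N.cutCost_nonneg F
      · exact ((lt_div_iff₀ h).1 (hcon F h)).le
  have : (0 : ℝ) < L * Nat.log 2 #Tm * β *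
    ∑ i, D i * (dist (s i) (t i) + dist (t i) (s i)) := by positivity
  nlinarith

theorem exists_sparse_cut (hst : ∀ i, s i ≠ t i) (hD : ∀ i, 0 ≤ D i) (hDpos : ∃ i, 0 < D i)
    {Tm : Finset V} (hs : ∀ i, s i ∈ Tm) (ht : ∀ i, t i ∈ Tm) (hTm : 2 ≤ #Tm)
    {L : ℕ} (hTL : 2 * #Tm ≤ 2 ^ L) :
    ∃ F, 0 < N.sepDemandSym s t D F ∧ N.cutCost F / N.sepDemandSym s t D F ≤
      33 * L * Nat.log 2 #Tm * N.maxConcurrentSym s t D := by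
  set β := N.maxConcurrentSym s t D with hβ
  have hβ0 : 0 ≤ β := maxConcurrentSym_nonneg hst hDpos
  have hcut : ∀ β', β < β' → ∃ F, 0 < N.sepDemandSym s t D F ∧
      N.cutCost F / N.sepDemandSym s t D F ≤ 33 * L * Nat.log 2 #Tm * β' := fun β' hβ' =>
    exists_sparse_cut_of_not_exists_isFlow hD hs ht hTm hTL (hβ0.trans_lt hβ') fun h =>
      hβ'.not_ge (le_csSup (bddAbove_concurrentSym hst hDpos) h)
  obtain ⟨F₁, hF₁, -⟩ := hcut (β + 1) (lt_add_one β)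
  obtain ⟨F₀, hF₀, hmin⟩ := exists_min_image (univ.filter fun F => 0 < N.sepDemandSym s t D F)
    (fun F => N.cutCost F / N.sepDemandSym s t D F) ⟨F₁, by simpa using hF₁⟩
  refine ⟨F₀, (mem_filter.1 hF₀).2, ?_⟩
  have hK : (0 : ℝ) ≤ 33 * L * Nat.log 2 #Tm := by positivity
  have hlim : Filter.Tendsto (fun β' : ℝ => 33 * L * Nat.log 2 #Tm * β')
      (nhdsWithin β (Set.Ioi β)) (nhds (33 * L * Nat.log 2 #Tm * β)) :=
    ((continuous_const.mul continuous_id).tendsto β).mono_left nhdsWithin_le_nhds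
  refine ge_of_tendsto hlim ?_
  filter_upwards [self_mem_nhdsWithin] with β' hβ'
  obtain ⟨F, hF, hle⟩ := hcut β' hβ'
  exact (hmin F (by simpa using hF)).trans hle

end Sym

end DirPolyNet

theorem mul_log_le_log_sq {m : ℕ} (hm : 2 ≤ m) :
    33 * ((Nat.clog 2 m + 1 : ℕ) : ℝ) * Nat.log 2 m ≤ 396 * Real.log m ^ 2 := by
  have h1 : 1 ≤ Nat.log 2 m := Nat.log_pos one_lt_two hm
  have h2 : Nat.clog 2 m ≤ Nat.log 2 m + 1 :=
    Nat.clog_le_of_le_pow (Nat.lt_pow_succ_log_self one_lt_two m).le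
  have h3 : (Nat.log 2 m : ℝ) * Real.log 2 ≤ Real.log m := by
    rw [← Real.log_pow]
    refine Real.log_le_log (by positivity) ?_
    exact_mod_cast Nat.pow_log_le_self 2 (by omega)
  have h4 := Real.log_two_gt_d9
  have h5 : (1 : ℝ) ≤ Nat.log 2 m := by exact_mod_cast h1
  have h6 : ((Nat.clog 2 m + 1 : ℕ) : ℝ) ≤ 3 * Nat.log 2 m := by
    have : Nat.clog 2 m + 1 ≤ 3 * Nat.log 2 m := by omega
    exact_mod_cast this
  have h7 : (Nat.log 2 m : ℝ) ≤ 2 * Real.log m := by nlinarith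
  calc 33 * ((Nat.clog 2 m + 1 : ℕ) : ℝ) * Nat.log 2 m
      ≤ 33 * (3 * Nat.log 2 m) * Nat.log 2 m := by gcongr
    _ = 99 * (Nat.log 2 m : ℝ) ^ 2 := by ring
    _ ≤ 99 * (2 * Real.log m) ^ 2 := by gcongr
    _ = _ := by ring

theorem log_sq_le_mul_log_cube {m k : ℕ} (hm : 2 ≤ m) (hk : 2 ≤ k) (hmk : m ≤ 2 * k) :
    Real.log m ^ 2 ≤ 8 * Real.log k ^ 3 := by
  have hk2 : Real.log 2 ≤ Real.log k := Real.log_le_log two_pos (by exact_mod_cast hk)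
  have h0 : 0 ≤ Real.log m := Real.log_natCast_nonneg m
  have h4 := Real.log_two_gt_d9
  have h1 : Real.log m ≤ 2 * Real.log k := by
    have : Real.log m ≤ Real.log (2 * k) :=
      Real.log_le_log (by positivity) (by exact_mod_cast hmk)
    rw [Real.log_mul two_ne_zero (by positivity)] at this
    linarith
  calc Real.log m ^ 2 ≤ (2 * Real.log k) ^ 2 := by gcongr
    _ = 4 * Real.log k ^ 2 * 1 := by ring
    _ ≤ 4 * Real.log k ^ 2 * (2 * Real.log k) := by gcongr; linarith
    _ = _ := by ring

theorem log_log_three_pos : 0 < Real.log (Real.log 3) := by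
  refine Real.log_pos ?_
  rw [Real.lt_log_iff_exp_lt three_pos]
  linarith [Real.exp_one_lt_d9]

theorem log_sq_le_mul_log_log {m n : ℕ} (hm : 2 ≤ m) (hn : 3 ≤ n) (hmn : m ≤ n) :
    Real.log m ^ 2 ≤
      1 / Real.log (Real.log 3) * (Real.log n ^ 2 * Real.log (Real.log n)) := by
  have hγ := log_log_three_pos
  have h3 : 0 < Real.log 3 := Real.log_pos (by norm_num)
  have h0 : 0 ≤ Real.log m := Real.log_natCast_nonneg m
  have h1 : Real.log m ≤ Real.log n := Real.log_le_log (by positivity) (by exact_mod_cast hmn)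
  have h2 : Real.log (Real.log 3) ≤ Real.log (Real.log n) :=
    Real.log_le_log h3 (Real.log_le_log three_pos (by exact_mod_cast hn))
  rw [one_div, ← div_eq_inv_mul, le_div_iff₀ hγ]
  gcongr

/-- There is a universal constant `C` such that in every directed
polymatroidal network on `n ≥ 3` nodes, for any multicommodity flow instance with
symmetric demands on `k ≥ 2` unordered pairs with demands `D`, there is an edge set
`F` whose sparsity `ν(F)/D(F)` is at most
`C · min{(log k)³, (log n)²·(log log n)} · β`, where `β` is the maximum concurrent flow. -/
theorem sparsest_cut_gap_symmetric_demands :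
    ∃ C : ℝ, 0 < C ∧
      ∀ (V E : Type) [Fintype V] [Fintype E] [DecidableEq V] [DecidableEq E]
        (N : DirPolyNet V E) (k : ℕ) (s t : Fin k → V) (D : Fin k → ℝ),
        3 ≤ Fintype.card V → 2 ≤ k →
        (∀ i, s i ≠ t i) →
        (∀ i, 0 ≤ D i) → (∃ i, 0 < D i) →
        ∃ F : Finset E, 0 < N.sepDemandSym s t D F ∧
          N.cutCost F / N.sepDemandSym s t D F ≤
            C * min ((Real.log k) ^ 3)
                ((Real.log (Fintype.card V)) ^ 2 *
                  Real.log (Real.log (Fintype.card V))) *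
              N.maxConcurrentSym s t D := by
  have hγ := log_log_three_pos
  refine ⟨396 * (8 + 1 / Real.log (Real.log 3)), by positivity, ?_⟩
  intro V E _ _ _ _ N k s t D hn hk hst hD hDpos
  set Tm : Finset V := univ.image s ∪ univ.image t with hTm
  have hs : ∀ i, s i ∈ Tm := fun i => by simp [hTm]
  have ht : ∀ i, t i ∈ Tm := fun i => by simp [hTm]
  have hm2 : 2 ≤ #Tm := by
    obtain ⟨i, -⟩ := hDpos
    exact one_lt_card.2 ⟨s i, hs i, t i, ht i, hst i⟩
  have hmk : #Tm ≤ 2 * k := by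
    refine (card_union_le _ _).trans ?_
    have h1 := card_image_le (s := univ) (f := s)
    have h2 := card_image_le (s := univ) (f := t)
    rw [card_univ, Fintype.card_fin] at h1 h2
    omega
  have hmn : #Tm ≤ Fintype.card V := card_le_univ _
  obtain ⟨F, hF, hle⟩ := exists_sparse_cut (N := N) hst hD hDpos hs ht hm2
    (L := Nat.clog 2 #Tm + 1) (by
      rw [pow_succ, mul_comm]
      exact Nat.mul_le_mul_right _ (Nat.le_pow_clog one_lt_two _))
  refine ⟨F, hF, hle.trans (mul_le_mul_of_nonneg_right ?_ (maxConcurrentSym_nonneg hst hDpos))⟩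
  refine (mul_log_le_log_sq hm2).trans ?_
  rw [mul_assoc]
  refine mul_le_mul_of_nonneg_left ?_ (by norm_num)
  have hγ' : 0 < 1 / Real.log (Real.log 3) := by positivity
  rcases min_choice (Real.log k ^ 3)
    (Real.log (Fintype.card V) ^ 2 * Real.log (Real.log (Fintype.card V))) with h | h <;> rw [h]
  · refine (log_sq_le_mul_log_cube hm2 hk hmk).trans ?_
    have := Real.log_natCast_nonneg k
    gcongr
    linarith
  · have h1 := log_sq_le_mul_log_log hm2 hn hmn
    refine h1.trans (mul_le_mul_of_nonneg_right (by linarith) ?_)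
    refine pos_of_mul_pos_right (lt_of_lt_of_le ?_ h1) hγ'.le |>.le
    have : 0 < Real.log #Tm := Real.log_pos (by exact_mod_cast hm2)
    positivity
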